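/- arXiv:1905.03568 — 2 statements merged into one kernel-verified Lean document; each statement's English description precedes it below -/
import Mathlib

section
/- Let M, N ≥ 1 be integers, let φ : [1,∞) → (0,1] be non-increasing, and let L ∈ ℝ^{M×N} be φ-semi multiplicatively badly approximable. Let ε, T > 0 and Q ≥ 1 satisfy T^M/ε ≥ e^M (e the base of the natural logarithm). Then there is a constant c > 0 depending only on M and N such that |#((Λ_L ∩ Z) \ C) − Vol(Z)| ≤ c · (1+T)^{M+N−1} · (log(T^M/ε))^{M−1} · (ε Q^N / φ(Q))^{(M+N−1)/(M+N)}, where Vol(Z) denotes the Lebesgue measure of Z. Equivalently, #((Λ_L ∩ Z) \ C) = #{(p,q) ∈ ℤ^M × (ℤ^N \ {0}) : ∏_{i=1}^M |L_i(q)+p_i| < ε, |L_i(q)+p_i| ≤ T for all i, and |q_j| ≤ Q for all j}. -/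
open scoped BigOperators

/-- distance from a real number to the nearest integer -/
noncomputable def distNearestInt (x : ℝ) : ℝ := |x - (round x : ℤ)|

/-- Lattice points of a set of bounded diameter, with respect to a seminorm that is at least `l` on
nonzero integer vectors. -/
theorem finite_and_ncard_le_of_seminorm {d : ℕ} (p : Seminorm ℝ (Fin d → ℝ)) {l D : ℝ} (hl : 0 < l)
    (hp : ∀ z : Fin d → ℤ, z ≠ 0 → l ≤ p (fun i => (z i : ℝ))) (hD : 0 ≤ D)
    (A : Set (Fin d → ℤ))
    (hA : ∀ x ∈ A, ∀ y ∈ A, p ((fun i => (x i : ℝ)) - (fun i => (y i : ℝ))) ≤ D) :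
    A.Finite ∧ (A.ncard : ℝ) ≤ (1 + D / l) ^ d := by
  set m : ℕ := ⌊D / l⌋₊ + 1 with hm
  have hml : D / l < m := by rw [hm]; push_cast; exact Nat.lt_floor_add_one _
  let f : (Fin d → ℤ) → (Fin d → ZMod m) := fun x i => (x i : ZMod m)
  have hf : Set.InjOn f A := by
    intro x hx y hy hxy
    have h1 : ∀ i, (m : ℤ) ∣ x i - y i := by
      intro i
      have := congrFun hxy i
      exact (ZMod.intCast_eq_intCast_iff_dvd_sub _ _ _).1 this.symm
    choose z hz using h1
    by_contra hne
    have hz0 : z ≠ 0 := by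
      rintro rfl
      apply hne
      ext i
      have := hz i
      simp at this
      omega
    have h2 := hA x hx y hy
    have h3 : ((fun i => (x i : ℝ)) - (fun i => (y i : ℝ))) = (m : ℝ) • (fun i => (z i : ℝ)) := by
      ext i
      have := hz i
      simp only [Pi.sub_apply, Pi.smul_apply, smul_eq_mul]
      exact_mod_cast this
    rw [h3, map_smul_eq_mul] at h2
    have h4 := hp z hz0
    rw [div_lt_iff₀ hl] at hml
    have : ‖(m : ℝ)‖ = m := by simp
    rw [this] at h2
    nlinarith [(Nat.cast_nonneg m : (0 : ℝ) ≤ m)]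
  have hfin : A.Finite := Set.Finite.of_finite_image (Set.toFinite _) hf
  refine ⟨hfin, ?_⟩
  have h5 : A.ncard ≤ m ^ d := by
    calc A.ncard = (f '' A).ncard := hf.ncard_image.symm
      _ ≤ Nat.card (Fin d → ZMod m) := Set.ncard_le_card _
      _ = m ^ d := by simp
  calc (A.ncard : ℝ) ≤ (m : ℝ) ^ d := by exact_mod_cast h5
    _ ≤ (1 + D / l) ^ d := by
      gcongr
      rw [hm]; push_cast
      have := Nat.floor_le (div_nonneg hD hl.le)
      linarith

/-- A bounded convex subset of the line contains as many integers as its length, up to one. -/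
theorem abs_ncard_int_sub_volume_le_one {I : Set ℝ} (hc : Convex ℝ I)
    (hb : Bornology.IsBounded I) :
    |(({t : ℤ | (t : ℝ) ∈ I}.ncard : ℕ) : ℝ) - (MeasureTheory.volume I).toReal| ≤ 1 := by
  rcases I.eq_empty_or_nonempty with rfl | hne
  · simp
  have hba := hb.bddAbove
  have hbb := hb.bddBelow
  set a := sInf I with ha
  set b := sSup I with hbd
  have hab : a ≤ b := csInf_le_csSup hne hbb hba
  have hsub : I ⊆ Set.Icc a b := fun x hx => ⟨csInf_le hbb hx, le_csSup hba hx⟩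
  have hsup : Set.Ioo a b ⊆ I := by
    rintro x ⟨h1, h2⟩
    obtain ⟨y, hy, hyx⟩ := exists_lt_of_csInf_lt hne h1
    obtain ⟨w, hw, hxw⟩ := exists_lt_of_lt_csSup hne h2
    exact hc.ordConnected.out hy hw ⟨hyx.le, hxw.le⟩
  have hvol : (MeasureTheory.volume I).toReal = b - a := by
    have h1 := MeasureTheory.measure_mono (μ := MeasureTheory.volume) hsub
    have h2 := MeasureTheory.measure_mono (μ := MeasureTheory.volume) hsup
    rw [Real.volume_Icc] at h1
    rw [Real.volume_Ioo] at h2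
    rw [le_antisymm h1 h2, ENNReal.toReal_ofReal (by linarith)]
  have hs1 : {t : ℤ | (t : ℝ) ∈ I} ⊆ ↑(Finset.Icc ⌈a⌉ ⌊b⌋) := by
    intro t ht
    have := hsub ht
    simp only [Finset.coe_Icc, Set.mem_Icc]
    exact ⟨Int.ceil_le.2 this.1, Int.le_floor.2 this.2⟩
  have hs2 : (↑(Finset.Ioo ⌊a⌋ ⌈b⌉) : Set ℤ) ⊆ {t : ℤ | (t : ℝ) ∈ I} := by
    intro t ht
    simp only [Finset.coe_Ioo, Set.mem_Ioo] at ht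
    exact hsup ⟨Int.floor_lt.1 ht.1, Int.lt_ceil.1 ht.2⟩
  have hfin : {t : ℤ | (t : ℝ) ∈ I}.Finite := (Finset.finite_toSet _).subset hs1
  have c1 := Set.ncard_le_ncard hs1 (Finset.finite_toSet _)
  have c2 := Set.ncard_le_ncard hs2 hfin
  rw [Set.ncard_coe_finset, Int.card_Icc] at c1
  rw [Set.ncard_coe_finset, Int.card_Ioo] at c2
  have f1 := Int.floor_le b
  have f2 := Int.le_ceil a
  have f3 := Int.floor_le a
  have f4 := Int.le_ceil b
  have f5 := Int.lt_floor_add_one b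
  have f6 := Int.ceil_lt_add_one a
  have f7 : -1 ≤ ⌊b⌋ - ⌈a⌉ := by
    have : (-2 : ℝ) < ((⌊b⌋ - ⌈a⌉ : ℤ) : ℝ) := by push_cast; linarith
    have : (-2 : ℤ) < ⌊b⌋ - ⌈a⌉ := by exact_mod_cast this
    omega
  have d1 : (({t : ℤ | (t : ℝ) ∈ I}.ncard : ℕ) : ℤ) ≤ ⌊b⌋ + 1 - ⌈a⌉ := by omega
  have d2 : ⌈b⌉ - ⌊a⌋ - 1 ≤ (({t : ℤ | (t : ℝ) ∈ I}.ncard : ℕ) : ℤ) := by omega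
  have e1 : (({t : ℤ | (t : ℝ) ∈ I}.ncard : ℕ) : ℝ) ≤ ⌊b⌋ + 1 - ⌈a⌉ := by exact_mod_cast d1
  have e2 : (⌈b⌉ - ⌊a⌋ - 1 : ℝ) ≤ (({t : ℤ | (t : ℝ) ∈ I}.ncard : ℕ) : ℝ) := by exact_mod_cast d2
  rw [hvol, abs_le]
  constructor <;> linarith

/-- A primitive integer vector is the first column of a unimodular matrix. -/
theorem exists_isUnit_det_mulVec_single {n : ℕ} (v : Fin (n + 1) → ℤ)
    (hv : ∀ (k : ℤ) (u : Fin (n + 1) → ℤ), v = k • u → IsUnit k) :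
    ∃ A : Matrix (Fin (n + 1)) (Fin (n + 1)) ℤ, IsUnit A.det ∧ A.mulVec (Pi.single 0 1) = v := by
  obtain ⟨f, hf⟩ : ∃ f : (Fin (n + 1) → ℤ) →ₗ[ℤ] ℤ, f v = 1 := by
    let J : Ideal ℤ := LinearMap.range (Module.Dual.eval ℤ (Fin (n + 1) → ℤ) v)
    obtain ⟨k, hk⟩ := (IsPrincipalIdealRing.principal J).principal
    have h1 : ∀ i, ∃ c, v i = k * c := by
      intro i
      have : v i ∈ J := ⟨LinearMap.proj i, rfl⟩
      rw [hk] at this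
      obtain ⟨c, hc⟩ := Submodule.mem_span_singleton.1 this
      exact ⟨c, by rw [← hc, smul_eq_mul, mul_comm]⟩
    choose u hu using h1
    have hk1 : IsUnit k := hv k u (funext fun i => by simp [hu i])
    have : (1 : ℤ) ∈ J := by
      rw [hk]
      obtain ⟨w, rfl⟩ := hk1
      exact Submodule.mem_span_singleton.2 ⟨((w⁻¹ : ℤˣ) : ℤ), by simp⟩
    obtain ⟨f, hf⟩ := this
    exact ⟨f, hf⟩
  have hrank : Module.finrank ℤ (LinearMap.ker f) = n := by
    have h1 := (LinearMap.ker f).finrank_quotient_add_finrank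
    rw [f.quotKerEquivRange.finrank_eq] at h1
    have h2 : LinearMap.range f = ⊤ := by
      rw [LinearMap.range_eq_top]
      intro c
      exact ⟨c • v, by rw [map_smul, hf]; simp⟩
    rw [h2] at h1
    simp at h1
    omega
  let b : Module.Basis (Fin n) ℤ (LinearMap.ker f) := Module.finBasisOfFinrankEq ℤ _ hrank
  let B : Module.Basis (Fin (n + 1)) ℤ (Fin (n + 1) → ℤ) := Module.Basis.mkFinCons v b
    (by
      intro c x hx h
      have := congrArg f h
      rw [LinearMap.mem_ker] at hx
      rw [map_add, map_smul, hf, hx] at this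
      simpa using this)
    (by
      intro z
      exact ⟨- f z, by
        rw [LinearMap.mem_ker, map_add, map_smul, hf]
        simp⟩)
  refine ⟨(Pi.basisFun ℤ (Fin (n + 1))).toMatrix B, ?_, ?_⟩
  · rw [← Matrix.isUnit_iff_isUnit_det]
    have := Module.Basis.invertibleToMatrix (Pi.basisFun ℤ (Fin (n + 1))) B
    exact isUnit_of_invertible _
  · ext i
    simp [Module.Basis.toMatrix_apply, B]

/-- A norming functional for a vector of positive seminorm. -/
theorem Seminorm.exists_dual_vector {E : Type*} [AddCommGroup E] [Module ℝ E] (p : Seminorm ℝ E)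
    (e : E) (he : 0 < p e) : ∃ f : E →ₗ[ℝ] ℝ, f e = 1 ∧ ∀ x, |f x| * p e ≤ p x := by
  have he0 : e ≠ 0 := by
    rintro rfl
    simp at he
  obtain ⟨g, hg, hgp⟩ := exists_extension_of_le_sublinear
    (LinearPMap.mkSpanSingleton e (p e) he0) p
    (fun c hc x => by rw [map_smul_eq_mul, Real.norm_of_nonneg hc.le])
    (fun x y => map_add_le_add p x y) (by
      rintro ⟨x, hx⟩
      obtain ⟨c, rfl⟩ := Submodule.mem_span_singleton.1 hx
      rw [LinearPMap.mkSpanSingleton'_apply, map_smul_eq_mul, smul_eq_mul]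
      gcongr
      exact le_abs_self c)
  have hge : g e = p e := by
    have := hg ⟨e, Submodule.mem_span_singleton_self e⟩
    rw [this]
    exact LinearPMap.mkSpanSingleton_apply ℝ ℝ he0 (p e)
  refine ⟨(p e)⁻¹ • g, by simp [hge, he.ne'], fun x => ?_⟩
  have h1 : |g x| ≤ p x := by
    rw [abs_le]
    have h2 := hgp (-x)
    rw [map_neg, map_neg_eq_map] at h2
    exact ⟨by linarith, hgp x⟩
  simp only [LinearMap.smul_apply, smul_eq_mul, abs_mul, abs_inv, abs_of_pos he]
  field_simp
  exact h1

/-- Counting the integer points of a set fibre by fibre along the first coordinate. -/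
theorem ncard_int_eq_sum_ncard_fiber {n : ℕ} (S : Set (Fin (n + 1) → ℝ))
    (hS : {z : Fin (n + 1) → ℤ | (fun i => (z i : ℝ)) ∈ S}.Finite) (W : Finset (Fin n → ℤ))
    (hW : ∀ (t : ℝ) (w : Fin n → ℤ),
      (Fin.cons t (fun i => (w i : ℝ)) : Fin (n + 1) → ℝ) ∈ S → w ∈ W) :
    {z : Fin (n + 1) → ℤ | (fun i => (z i : ℝ)) ∈ S}.ncard =
      ∑ w ∈ W, {t : ℤ | (Fin.cons (t : ℝ) (fun i => (w i : ℝ)) : Fin (n + 1) → ℝ) ∈ S}.ncard := by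
  classical
  have hcast : ∀ (t : ℤ) (w : Fin n → ℤ),
      (fun i => (((Fin.cons t w : Fin (n + 1) → ℤ) i : ℤ) : ℝ)) =
        (Fin.cons (t : ℝ) (fun i => (w i : ℝ)) : Fin (n + 1) → ℝ) := by
    intro t w
    ext i
    refine Fin.cases ?_ (fun j => ?_) i <;> simp
  rw [Set.ncard_eq_toFinset_card _ hS, Finset.card_eq_sum_card_fiberwise (f := Fin.tail) (t := W)]
  · refine Finset.sum_congr rfl fun w _ => ?_
    rw [← Set.ncard_coe_finset]
    have hinj : Function.Injective (fun t : ℤ => (Fin.cons t w : Fin (n + 1) → ℤ)) :=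
      fun a b h => (Fin.cons_injective2 h).1
    rw [← Set.ncard_image_of_injective _ hinj]
    congr 1
    ext z
    simp only [Finset.coe_filter, Set.Finite.mem_toFinset, Set.mem_ofPred_eq, Set.mem_image]
    constructor
    · rintro ⟨h1, rfl⟩
      refine ⟨z 0, ?_, Fin.cons_self_tail z⟩
      rwa [← hcast, Fin.cons_self_tail]
    · rintro ⟨t, ht, rfl⟩
      rw [hcast]
      exact ⟨ht, Fin.tail_cons _ _⟩
  · intro z hz
    simp only [Set.Finite.coe_toFinset, Set.mem_ofPred_eq] at hz
    refine hW (z 0) (Fin.tail z) ?_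
    rw [← hcast, Fin.cons_self_tail]
    exact hz

theorem measurable_cons (n : ℕ) :
    Measurable (fun x : ℝ × (Fin n → ℝ) => (Fin.cons x.1 x.2 : Fin (n + 1) → ℝ)) := by
  rw [measurable_pi_iff]
  refine Fin.cases ?_ (fun j => ?_)
  · simpa using measurable_fst
  · simp only [Fin.cons_succ]
    fun_prop

/-- Volume of a set as the volume of its image under a shear along the first coordinate. -/
theorem volume_shear_cons {n : ℕ} {S : Set (Fin (n + 1) → ℝ)} (hS : MeasurableSet S)
    {g : (Fin n → ℝ) → ℝ} (hg : Measurable g) :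
    MeasureTheory.volume
      {x : ℝ × (Fin n → ℝ) | (Fin.cons (x.1 - g x.2) x.2 : Fin (n + 1) → ℝ) ∈ S} =
      MeasureTheory.volume S := by
  have hcons := measurable_cons n
  have hsh : Measurable (fun x : ℝ × (Fin n → ℝ) => (x.1 - g x.2, x.2)) := by fun_prop
  have h0 : MeasureTheory.volume {x : ℝ × (Fin n → ℝ) | (Fin.cons x.1 x.2 : Fin (n + 1) → ℝ) ∈ S}
      = MeasureTheory.volume S := by
    have := (MeasureTheory.volume_preserving_piFinSuccAbove (fun _ : Fin (n + 1) => ℝ) 0).symm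
    rw [← this.measure_preimage hS.nullMeasurableSet]
    congr 1
    ext x
    simp [MeasurableEquiv.piFinSuccAbove, Fin.insertNthEquiv]
  have h1 : MeasurableSet
      {x : ℝ × (Fin n → ℝ) | (Fin.cons (x.1 - g x.2) x.2 : Fin (n + 1) → ℝ) ∈ S} :=
    hcons.comp hsh hS
  have h2 : MeasurableSet {x : ℝ × (Fin n → ℝ) | (Fin.cons x.1 x.2 : Fin (n + 1) → ℝ) ∈ S} :=
    hcons hS
  rw [← h0, MeasureTheory.Measure.volume_eq_prod, MeasureTheory.Measure.prod_apply_symm h1,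
    MeasureTheory.Measure.prod_apply_symm h2]
  refine MeasureTheory.lintegral_congr fun w => ?_
  rw [← MeasureTheory.measure_preimage_add_right MeasureTheory.volume (-g w)
    ((fun t => (t, w)) ⁻¹' {x : ℝ × (Fin n → ℝ) | (Fin.cons x.1 x.2 : Fin (n + 1) → ℝ) ∈ S})]
  simp only [Set.preimage, Set.mem_ofPred_eq, ← sub_eq_add_neg]

/-- The bound `c (1 + D / l) ^ (d - 1)` for the discrepancy between the number of integer points and
the volume of a bounded convex set in `ℝ^d`, where `D` bounds the diameter of the set and `l` is
a lower bound for the length of nonzero integer vectors, both in terms of the same seminorm. -/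
def ConvexCountBound (d : ℕ) (c : ℝ) : Prop :=
  ∀ (p : Seminorm ℝ (Fin d → ℝ)) (l D : ℝ), 0 < l →
    (∀ z : Fin d → ℤ, z ≠ 0 → l ≤ p (fun i => (z i : ℝ))) → 0 ≤ D →
    ∀ S : Set (Fin d → ℝ), Convex ℝ S → MeasurableSet S → Bornology.IsBounded S →
      (∀ x ∈ S, ∀ y ∈ S, p (x - y) ≤ D) →
      |({z : Fin d → ℤ | (fun i => (z i : ℝ)) ∈ S}.ncard : ℝ) -
        (MeasureTheory.volume S).toReal| * (1 + D / l) ≤ c * (1 + D / l) ^ d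

theorem cons_eq_smul_single_add {n : ℕ} (a t : ℝ) (w : Fin n → ℝ) :
    (Fin.cons t w : Fin (n + 1) → ℝ) =
      (t - a) • (Pi.single 0 1 : Fin (n + 1) → ℝ) + (Fin.cons a w : Fin (n + 1) → ℝ) := by
  ext i
  refine Fin.cases ?_ (fun j => ?_) i <;> simp

/-- Inductive step of the discrepancy bound when the first basis vector is almost shortest. -/
theorem ConvexCountBound.abs_ncard_sub_volume_le {n : ℕ} {c : ℝ} (hc : 0 ≤ c)
    (ih : ConvexCountBound n c) (p : Seminorm ℝ (Fin (n + 1) → ℝ)) {l D : ℝ} (hl : 0 < l)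
    (hp : ∀ z : Fin (n + 1) → ℤ, z ≠ 0 → l ≤ p (fun i => (z i : ℝ)))
    (he : p (Pi.single 0 1) ≤ 3 / 2 * l) (hD : 0 ≤ D) (S : Set (Fin (n + 1) → ℝ))
    (hS : Convex ℝ S) (hSm : MeasurableSet S) (hSb : Bornology.IsBounded S)
    (hSD : ∀ x ∈ S, ∀ y ∈ S, p (x - y) ≤ D) :
    |({z : Fin (n + 1) → ℤ | (fun i => (z i : ℝ)) ∈ S}.ncard : ℝ) -
        (MeasureTheory.volume S).toReal| ≤ 8 ^ n * (1 + c) * (1 + D / l) ^ n := by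
  classical
  rcases S.eq_empty_or_nonempty with rfl | ⟨x₀, hx₀⟩
  · have : 0 ≤ D / l := by positivity
    simp
    positivity
  set R := D / l with hR
  have hR0 : 0 ≤ R := by positivity
  set e : Fin (n + 1) → ℝ := Pi.single 0 1 with hedef
  have hle : l ≤ p e := by
    have h := hp (Pi.single 0 1) (by simp)
    convert h using 2
    ext i
    refine Fin.cases ?_ (fun j => ?_) i <;> simp [hedef]
  obtain ⟨f, hfe, hf⟩ := p.exists_dual_vector e (hl.trans_le hle)
  let ι₀ : (Fin n → ℝ) →ₗ[ℝ] (Fin (n + 1) → ℝ) :=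
    { toFun := fun w => Fin.cons 0 w
      map_add' := fun x y => by
        ext i
        refine Fin.cases ?_ (fun j => ?_) i <;> simp
      map_smul' := fun a x => by
        ext i
        refine Fin.cases ?_ (fun j => ?_) i <;> simp }
  let g : (Fin n → ℝ) →ₗ[ℝ] ℝ := f ∘ₗ ι₀
  have hgm : Measurable g := g.continuous_of_finiteDimensional.measurable
  let ι : (Fin n → ℝ) →ₗ[ℝ] (Fin (n + 1) → ℝ) := ι₀ - (LinearMap.toSpanSingleton ℝ _ e) ∘ₗ g
  have hι : ∀ w, ι w = Fin.cons (-g w) w := by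
    intro w
    rw [cons_eq_smul_single_add 0]
    simp only [ι, ι₀, LinearMap.sub_apply, LinearMap.comp_apply, LinearMap.toSpanSingleton_apply,
      LinearMap.coe_mk, AddHom.coe_mk, sub_zero, neg_smul]
    rw [← hedef]
    abel
  have hfc : ∀ t w, f (Fin.cons t w) = t + g w := by
    intro t w
    rw [cons_eq_smul_single_add 0, map_add, map_smul, ← hedef, hfe]
    simp [g, ι₀]
  let p' : Seminorm ℝ (Fin n → ℝ) := p.comp ι
  have hp'le : ∀ t w, p' w ≤ 2 * p (Fin.cons t w) := by
    intro t w
    have h1 : ι w = (Fin.cons t w : Fin (n + 1) → ℝ) - (t + g w) • e := by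
      rw [hι, cons_eq_smul_single_add (-g w) t w, ← hedef, sub_neg_eq_add]
      abel
    have h2 := hf (Fin.cons t w)
    rw [hfc] at h2
    calc p' w = p (ι w) := rfl
      _ ≤ p (Fin.cons t w) + p ((t + g w) • e) := by rw [h1]; exact map_sub_le_add p _ _
      _ = p (Fin.cons t w) + |t + g w| * p e := by rw [map_smul_eq_mul, Real.norm_eq_abs]
      _ ≤ 2 * p (Fin.cons t w) := by linarith
  have hp' : ∀ z : Fin n → ℤ, z ≠ 0 → l / 4 ≤ p' (fun i => (z i : ℝ)) := by
    intro z hz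
    set w : Fin n → ℝ := fun i => (z i : ℝ) with hw
    have h1 := hp (Fin.cons (round (-g w)) z) (fun h => hz (by
      ext i
      simpa using congrFun h i.succ))
    have h2 : (fun i => (((Fin.cons (round (-g w)) z : Fin (n + 1) → ℤ) i : ℤ) : ℝ)) =
        ((round (-g w) : ℝ) - (-g w)) • e + ι w := by
      rw [hι, ← cons_eq_smul_single_add]
      ext i
      refine Fin.cases ?_ (fun j => ?_) i <;> simp [hw]
    rw [h2] at h1
    have h3 : p (((round (-g w) : ℝ) - (-g w)) • e + ι w) ≤
        |(round (-g w) : ℝ) - (-g w)| * p e + p' w := by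
      refine (map_add_le_add p _ _).trans ?_
      rw [map_smul_eq_mul, Real.norm_eq_abs]
      rfl
    have h4 := abs_sub_round (-g w)
    rw [abs_sub_comm] at h4
    nlinarith [abs_nonneg ((round (-g w) : ℝ) - (-g w)), apply_nonneg p e]
  set W : Set (Fin n → ℤ) :=
    {w | ∃ t : ℝ, (Fin.cons t (fun i => (w i : ℝ)) : Fin (n + 1) → ℝ) ∈ S} with hWdef
  obtain ⟨hWf, hWc⟩ := finite_and_ncard_le_of_seminorm p' (by positivity : 0 < l / 4) hp'
    (by positivity : 0 ≤ 2 * D) W (by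
      rintro w ⟨t, ht⟩ w' ⟨t', ht'⟩
      have h1 := hSD _ ht _ ht'
      refine (hp'le (t - t') _).trans ?_
      have h2 : (Fin.cons (t - t') ((fun i => (w i : ℝ)) - fun i => (w' i : ℝ)) :
          Fin (n + 1) → ℝ) =
          (Fin.cons t fun i => (w i : ℝ)) - (Fin.cons t' fun i => (w' i : ℝ)) := by
        ext i
        refine Fin.cases ?_ (fun j => ?_) i <;> simp
      rw [h2]
      linarith)
  have hSf := (finite_and_ncard_le_of_seminorm p hl hp hD
    {z : Fin (n + 1) → ℤ | (fun i => (z i : ℝ)) ∈ S} fun x hx y hy => hSD _ hx _ hy).1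
  set Wf := hWf.toFinset with hWfdef
  have hWmem : ∀ (t : ℝ) (w : Fin n → ℤ),
      (Fin.cons t (fun i => (w i : ℝ)) : Fin (n + 1) → ℝ) ∈ S → w ∈ Wf := by
    intro t w h
    rw [hWfdef, Set.Finite.mem_toFinset]
    exact ⟨t, h⟩
  have hcount := ncard_int_eq_sum_ncard_fiber S hSf Wf hWmem
  -- fibres over the first coordinate
  let fib : (Fin n → ℤ) → Set ℝ := fun w =>
    {t | (Fin.cons t (fun i => (w i : ℝ)) : Fin (n + 1) → ℝ) ∈ S}
  have hfibc : ∀ w, Convex ℝ (fib w) := by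
    intro w t ht t' ht' a b ha hb hab
    have := hS ht ht' ha hb hab
    show (Fin.cons _ _ : Fin (n + 1) → ℝ) ∈ S
    convert this using 1
    ext i
    refine Fin.cases ?_ (fun j => ?_) i
    · simp
    · simp [← add_mul, hab]
  have hfibb : ∀ w, Bornology.IsBounded (fib w) := by
    intro w
    refine (hSb.image_eval 0).subset ?_
    intro t ht
    exact ⟨_, ht, by simp⟩
  have hsum1 : |∑ w ∈ Wf, (({t : ℤ | (t : ℝ) ∈ fib w}.ncard : ℝ) -
      (MeasureTheory.volume (fib w)).toReal)| ≤ (1 + 8 * R) ^ n := by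
    refine (Finset.abs_sum_le_sum_abs _ _).trans ?_
    refine (Finset.sum_le_sum fun w _ =>
      abs_ncard_int_sub_volume_le_one (hfibc w) (hfibb w)).trans ?_
    rw [Finset.sum_const, nsmul_eq_mul, mul_one, hWfdef, ← Set.ncard_eq_toFinset_card W hWf]
    refine hWc.trans (le_of_eq ?_)
    rw [hR]
    field_simp
    ring
  -- slices transversal to the first coordinate
  let sl : ℝ → Set (Fin n → ℝ) := fun s =>
    {w | (Fin.cons (s - g w) w : Fin (n + 1) → ℝ) ∈ S}
  have hslm2 : MeasurableSet
      {x : ℝ × (Fin n → ℝ) | (Fin.cons (x.1 - g x.2) x.2 : Fin (n + 1) → ℝ) ∈ S} :=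
    (measurable_cons n).comp (by fun_prop :
      Measurable fun x : ℝ × (Fin n → ℝ) => (x.1 - g x.2, x.2)) hSm
  have hslm : ∀ s, MeasurableSet (sl s) := fun s => measurable_prodMk_left hslm2
  have hcι : ∀ s w, (Fin.cons (s - g w) w : Fin (n + 1) → ℝ) = s • e + ι w := by
    intro s w
    rw [hι, cons_eq_smul_single_add (-g w), ← hedef]
    congr 2
    ring
  have hslc : ∀ s, Convex ℝ (sl s) := by
    intro s w hw w' hw' a b ha hb hab
    have := hS hw hw' ha hb hab
    show (Fin.cons _ _ : Fin (n + 1) → ℝ) ∈ S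
    rw [hcι] at this ⊢
    rw [hcι] at this
    convert this using 1
    have hb' : b = 1 - a := by linarith
    subst hb'
    simp only [map_add, map_smul]
    module
  have hslb : ∀ s, Bornology.IsBounded (sl s) := by
    intro s
    rw [← Bornology.forall_isBounded_image_eval_iff]
    intro j
    refine (hSb.image_eval j.succ).subset ?_
    rintro _ ⟨w, hw, rfl⟩
    exact ⟨_, hw, by simp⟩
  have hslD : ∀ s, ∀ w ∈ sl s, ∀ w' ∈ sl s, p' (w - w') ≤ D := by
    intro s w hw w' hw'
    have := hSD _ hw _ hw'
    rw [hcι, hcι, add_sub_add_left_eq_sub, ← map_sub] at this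
    exact this
  have hslsupp : ∀ s, ∀ w ∈ sl s, s ∈ Set.Icc (f x₀ - R) (f x₀ + R) := by
    intro s w hw
    have h1 := hf ((Fin.cons (s - g w) w : Fin (n + 1) → ℝ) - x₀)
    rw [map_sub, hfc] at h1
    have h2 := hSD _ hw _ hx₀
    have h3 : |s - g w + g w - f x₀| ≤ R := by
      rw [hR, le_div_iff₀ hl]
      exact (mul_le_mul_of_nonneg_left hle (abs_nonneg _)).trans (h1.trans h2)
    rw [abs_le] at h3
    constructor <;> linarith
  let F : ℝ → ℝ := fun s => (MeasureTheory.volume (sl s)).toReal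
  let G : ℝ → ℝ := fun s => ({w : Fin n → ℤ | (fun i => (w i : ℝ)) ∈ sl s}.ncard : ℝ)
  have hGF : ∀ s, |G s - F s| * (1 + 4 * R) ≤ c * (1 + 4 * R) ^ n := by
    intro s
    have h := ih p' (l / 4) D (by positivity) hp' hD (sl s) (hslc s) (hslm s) (hslb s) (hslD s)
    have h4 : D / (l / 4) = 4 * R := by rw [hR]; field_simp
    rwa [h4] at h
  have hGFsupp : ∀ s, s ∉ Set.Icc (f x₀ - R) (f x₀ + R) → G s - F s = 0 := by
    intro s hs
    have : sl s = ∅ := Set.eq_empty_of_forall_notMem fun w hw => hs (hslsupp s w hw)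
    simp [G, F, this]
  have hvol := volume_shear_cons hSm hgm
  have hSfin : MeasureTheory.volume S ≠ ⊤ := hSb.measure_lt_top.ne
  have hFint : MeasureTheory.Integrable F := by
    refine MeasureTheory.Measure.integrable_measure_prodMk_left (μ := MeasureTheory.volume)
      (ν := MeasureTheory.volume) hslm2 ?_
    rw [← MeasureTheory.Measure.volume_eq_prod, hvol]
    exact hSfin
  have hFval : ∫ s, F s = (MeasureTheory.volume S).toReal := by
    rw [← hvol, MeasureTheory.Measure.volume_eq_prod, MeasureTheory.Measure.prod_apply hslm2]
    refine MeasureTheory.integral_toReal (measurable_measure_prodMk_left hslm2).aemeasurable ?_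
    exact Filter.Eventually.of_forall fun s => (hslb s).measure_lt_top
  let fib' : (Fin n → ℤ) → Set ℝ := fun w => {s | (fun i => (w i : ℝ)) ∈ sl s}
  have hfib'm : ∀ w, MeasurableSet (fib' w) := fun w => measurable_prodMk_right hslm2
  have hfib'v : ∀ w, MeasureTheory.volume (fib' w) = MeasureTheory.volume (fib w) := by
    intro w
    rw [← MeasureTheory.measure_preimage_add_right MeasureTheory.volume
      (-g (fun i => (w i : ℝ))) (fib w)]
    simp only [Set.preimage, fib, fib', sl, Set.mem_ofPred_eq, ← sub_eq_add_neg]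
  have hfibfin : ∀ w, MeasureTheory.volume (fib' w) < ⊤ := by
    intro w
    rw [hfib'v]
    exact (hfibb w).measure_lt_top
  have hGsum : G = fun s => ∑ w ∈ Wf, (fib' w).indicator (fun _ => (1 : ℝ)) s := by
    ext s
    have h1 : {w : Fin n → ℤ | (fun i => (w i : ℝ)) ∈ sl s} = ↑(Wf.filter fun w => s ∈ fib' w) := by
      ext w
      simp only [Set.mem_ofPred_eq, Finset.coe_filter, fib']
      exact ⟨fun h => ⟨hWmem _ w h, h⟩, fun h => h.2⟩
    simp only [G]
    rw [h1, Set.ncard_coe_finset, Finset.card_filter]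
    push_cast
    refine Finset.sum_congr rfl fun w _ => ?_
    simp [Set.indicator_apply]
  have hind : ∀ w ∈ Wf, MeasureTheory.Integrable ((fib' w).indicator (fun _ => (1 : ℝ))) := by
    intro w _
    exact (MeasureTheory.integrable_indicator_iff (hfib'm w)).2
      (MeasureTheory.integrableOn_const (hfibfin w).ne)
  have hGint : MeasureTheory.Integrable G := by
    rw [hGsum]
    exact MeasureTheory.integrable_finsetSum _ hind
  have hGval : ∫ s, G s = ∑ w ∈ Wf, (MeasureTheory.volume (fib w)).toReal := by
    rw [hGsum, MeasureTheory.integral_finsetSum _ hind]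
    refine Finset.sum_congr rfl fun w _ => ?_
    rw [MeasureTheory.integral_indicator (hfib'm w), ← hfib'v]
    simp [MeasureTheory.Measure.real]
  have hdiff : |∑ w ∈ Wf, (MeasureTheory.volume (fib w)).toReal -
      (MeasureTheory.volume S).toReal| ≤ c * (1 + 4 * R) ^ n := by
    rw [← hGval, ← hFval, ← MeasureTheory.integral_sub hGint hFint,
      ← MeasureTheory.setIntegral_eq_integral_of_forall_compl_eq_zero
        (s := Set.Icc (f x₀ - R) (f x₀ + R)) (fun s hs => hGFsupp s hs)]
    have h1 := MeasureTheory.norm_setIntegral_le_of_norm_le_const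
      (μ := MeasureTheory.volume) (s := Set.Icc (f x₀ - R) (f x₀ + R)) (f := fun s => G s - F s)
      (C := c * (1 + 4 * R) ^ n / (1 + 4 * R)) (by simp) (fun s _ => by
        rw [le_div_iff₀ (by positivity), Real.norm_eq_abs]
        exact hGF s)
    rw [Real.norm_eq_abs] at h1
    refine h1.trans ?_
    rw [Real.volume_real_Icc_of_le (by linarith), div_mul_eq_mul_div, div_le_iff₀ (by positivity)]
    refine mul_le_mul_of_nonneg_left ?_ (by positivity)
    linarith
  have htot : (({z : Fin (n + 1) → ℤ | (fun i => (z i : ℝ)) ∈ S}.ncard : ℕ) : ℝ) -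
      (MeasureTheory.volume S).toReal =
      ∑ w ∈ Wf, (({t : ℤ | (t : ℝ) ∈ fib w}.ncard : ℝ) - (MeasureTheory.volume (fib w)).toReal) +
      (∑ w ∈ Wf, (MeasureTheory.volume (fib w)).toReal - (MeasureTheory.volume S).toReal) := by
    rw [hcount, Finset.sum_sub_distrib]
    push_cast
    simp only [fib, Set.mem_ofPred_eq]
    ring
  rw [htot]
  have hb1 : (1 + 8 * R) ^ n ≤ 8 ^ n * (1 + R) ^ n := by
    rw [← mul_pow]; gcongr; linarith
  have hb2 : (1 + 4 * R) ^ n ≤ 8 ^ n * (1 + R) ^ n := by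
    rw [← mul_pow]; gcongr; linarith
  calc _ ≤ (1 + 8 * R) ^ n + c * (1 + 4 * R) ^ n := (abs_add_le _ _).trans (add_le_add hsum1 hdiff)
    _ ≤ 8 ^ n * (1 + R) ^ n + c * (8 ^ n * (1 + R) ^ n) := by gcongr
    _ = _ := by ring

theorem exists_convexCountBound (d : ℕ) : ∃ c : ℝ, 0 ≤ c ∧ ConvexCountBound d c := by
  induction d with
  | zero =>
    refine ⟨0, le_rfl, ?_⟩
    intro p l D hl hp hD S hS hSm hSb hSD
    rcases S.eq_empty_or_nonempty with rfl | hne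
    · simp
    · rw [Set.Nonempty.eq_univ hne]
      simp [MeasureTheory.volume_pi]
  | succ n ih =>
    obtain ⟨c, hc, ih⟩ := ih
    refine ⟨8 ^ n * (1 + c), by positivity, ?_⟩
    intro p l D hl hp hD S hS hSm hSb hSD
    set V : Set ℝ := {r | ∃ z : Fin (n + 1) → ℤ, z ≠ 0 ∧ p (fun i => (z i : ℝ)) = r} with hV
    have hVne : V.Nonempty := ⟨_, Pi.single 0 1, by simp, rfl⟩
    have hVb : BddBelow V := ⟨l, by rintro _ ⟨z, hz, rfl⟩; exact hp z hz⟩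
    set m := sInf V with hm
    have hlm : l ≤ m := le_csInf hVne (by rintro _ ⟨z, hz, rfl⟩; exact hp z hz)
    have hm0 : 0 < m := hl.trans_le hlm
    have hmp : ∀ z : Fin (n + 1) → ℤ, z ≠ 0 → m ≤ p (fun i => (z i : ℝ)) :=
      fun z hz => csInf_le hVb ⟨z, hz, rfl⟩
    obtain ⟨_, ⟨v, hv0, rfl⟩, hv⟩ := exists_lt_of_csInf_lt hVne
      (by linarith : sInf V < 3 / 2 * m)
    have hprim : ∀ (k : ℤ) (u : Fin (n + 1) → ℤ), v = k • u → IsUnit k := by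
      intro k u hku
      have hk0 : k ≠ 0 := by
        rintro rfl
        exact hv0 (by simpa using hku)
      have hu0 : u ≠ 0 := by
        rintro rfl
        exact hv0 (by simpa using hku)
      have h1 : (fun i => (v i : ℝ)) = (k : ℝ) • (fun i => (u i : ℝ)) := by
        ext i
        simp [hku]
      rw [h1, map_smul_eq_mul, Real.norm_eq_abs] at hv
      have h2 := hmp u hu0
      rw [Int.isUnit_iff_abs_eq]
      by_contra h3
      have h4 : 1 ≤ |k| := Int.one_le_abs hk0
      have h5 : 2 ≤ |k| := by omega
      have h6 : (2 : ℝ) ≤ |(k : ℝ)| := by exact_mod_cast h5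
      nlinarith
    obtain ⟨A, hA, hAv⟩ := exists_isUnit_det_mulVec_single v hprim
    set B : Matrix (Fin (n + 1)) (Fin (n + 1)) ℝ := A.map (Int.cast : ℤ → ℝ) with hB
    have hBdet : B.det = (A.det : ℝ) := (Int.cast_det A).symm
    have habs : |B.det| = 1 := by
      rw [hBdet]
      exact_mod_cast Int.isUnit_iff_abs_eq.1 hA
    have hBunit : IsUnit B.det := by
      rw [isUnit_iff_ne_zero]
      intro h
      simp [h] at habs
    set b := Matrix.toLin' B with hb
    have hbdet : LinearMap.det b = B.det := by rw [hb, LinearMap.det_toLin']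
    have hbcast : ∀ z : Fin (n + 1) → ℤ,
        b (fun i => (z i : ℝ)) = fun i => ((A.mulVec z i : ℤ) : ℝ) := by
      intro z
      ext i
      simp [hb, hB, Matrix.toLin'_apply, Matrix.mulVec, dotProduct]
    have hAinj : Function.Injective A.mulVec :=
      Matrix.mulVec_injective_of_isUnit ((Matrix.isUnit_iff_isUnit_det A).2 hA)
    have hAsurj : Function.Surjective A.mulVec :=
      Matrix.mulVec_surjective_iff_isUnit.2 ((Matrix.isUnit_iff_isUnit_det A).2 hA)
    have hbm : Measurable b := b.continuous_of_finiteDimensional.measurable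
    let bE : (Fin (n + 1) → ℝ) ≃L[ℝ] (Fin (n + 1) → ℝ) :=
      (LinearEquiv.ofIsUnitDet (f := b) (v := Pi.basisFun ℝ _) (v' := Pi.basisFun ℝ _)
        (by rwa [LinearMap.det_toMatrix, hbdet])).toContinuousLinearEquiv
    have hbE : ⇑bE = ⇑b := rfl
    have hbb : Bornology.IsBounded (b ⁻¹' S) := by
      rw [← hbE]
      exact bE.antilipschitz.isBounded_preimage hSb
    have key := ih.abs_ncard_sub_volume_le hc (p.comp b) hm0 (by
        intro z hz
        rw [Seminorm.comp_apply, hbcast]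
        refine hmp _ fun h => hz (hAinj ?_)
        simpa using h) (by
        have h1 : (Pi.single 0 1 : Fin (n + 1) → ℝ) =
            fun i => (((Pi.single 0 1 : Fin (n + 1) → ℤ) i : ℤ) : ℝ) := by
          ext i
          refine Fin.cases ?_ (fun j => ?_) i <;> simp
        rw [Seminorm.comp_apply, h1, hbcast, hAv]
        exact hv.le) hD (b ⁻¹' S) (hS.linear_preimage b) (hbm hSm) hbb (by
        intro x hx y hy
        rw [Seminorm.comp_apply, map_sub]
        exact hSD _ hx _ hy)
    have hvol : MeasureTheory.volume (b ⁻¹' S) = MeasureTheory.volume S := by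
      rw [MeasureTheory.Measure.addHaar_preimage_linearMap _
        (by rw [hbdet]; exact hBunit.ne_zero), hbdet, abs_inv, habs]
      simp
    have hcard : {z : Fin (n + 1) → ℤ | (fun i => (z i : ℝ)) ∈ b ⁻¹' S}.ncard =
        {z : Fin (n + 1) → ℤ | (fun i => (z i : ℝ)) ∈ S}.ncard := by
      rw [← Set.ncard_image_of_injective _ hAinj]
      congr 1
      ext z
      simp only [Set.mem_image, Set.mem_ofPred_eq, Set.mem_preimage, hbcast]
      constructor
      · rintro ⟨y, hy, rfl⟩
        exact hy
      · intro h
        obtain ⟨y, rfl⟩ := hAsurj z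
        exact ⟨y, h, rfl⟩
    rw [hvol, hcard] at key
    rw [pow_succ, ← mul_assoc]
    refine mul_le_mul_of_nonneg_right (key.trans ?_) (by positivity)
    gcongr

/-- The identification of `ℝ^(M+N)` with `ℝ^M × ℝ^N`. -/
def splitCoords (M N : ℕ) : (Fin (M + N) → ℝ) →ₗ[ℝ] (Fin M → ℝ) × (Fin N → ℝ) where
  toFun x := (fun i => x (Fin.castAdd N i), fun j => x (Fin.natAdd M j))
  map_add' _ _ := rfl
  map_smul' _ _ := rfl

theorem measurePreserving_splitCoords (M N : ℕ) :
    MeasureTheory.MeasurePreserving (splitCoords M N) := by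
  have h1 := MeasureTheory.volume_measurePreserving_piCongrLeft (fun _ : Fin M ⊕ Fin N => ℝ)
    finSumFinEquiv.symm
  have h2 := (MeasureTheory.volume_measurePreserving_sumPiEquivProdPi_symm
    (fun _ : Fin M ⊕ Fin N => ℝ)).symm
  have h3 : ⇑(splitCoords M N) =
      (MeasurableEquiv.sumPiEquivProdPi fun _ : Fin M ⊕ Fin N => ℝ).symm.symm ∘
        (MeasurableEquiv.piCongrLeft (fun _ : Fin M ⊕ Fin N => ℝ) finSumFinEquiv.symm) := by
    have h4 : ∀ (x : Fin (M + N) → ℝ) k, (MeasurableEquiv.piCongrLeft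
        (fun _ : Fin M ⊕ Fin N => ℝ) finSumFinEquiv.symm) x (finSumFinEquiv.symm k) = x k :=
      fun x k => Equiv.piCongrLeft_apply_apply (fun _ : Fin M ⊕ Fin N => ℝ) _ x k
    ext x i
    · have := h4 x (Fin.castAdd N i)
      rw [finSumFinEquiv_symm_apply_castAdd] at this
      exact this.symm
    · have := h4 x (Fin.natAdd M i)
      rw [finSumFinEquiv_symm_apply_natAdd] at this
      exact this.symm
  rw [h3]
  exact h2.comp h1

/-- Discrepancy bound for the points `(L q + p, q)` in a bounded convex set. -/
theorem exists_abs_ncard_sub_volume_le (M N : ℕ) : ∃ c : ℝ, 0 ≤ c ∧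
    ∀ (L : Matrix (Fin M) (Fin N) ℝ) (p : Seminorm ℝ ((Fin M → ℝ) × (Fin N → ℝ))) (l D : ℝ), 0 < l →
    (∀ z : (Fin M → ℤ) × (Fin N → ℤ), z ≠ 0 →
      l ≤ p ((fun i => ∑ j, L i j * (z.2 j : ℝ) + (z.1 i : ℝ)), fun j => (z.2 j : ℝ))) → 0 ≤ D →
    ∀ S : Set ((Fin M → ℝ) × (Fin N → ℝ)), Convex ℝ S → MeasurableSet S → Bornology.IsBounded S →
      (∀ x ∈ S, ∀ y ∈ S, p (x - y) ≤ D) →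
      |({z : (Fin M → ℤ) × (Fin N → ℤ) |
          ((fun i => ∑ j, L i j * (z.2 j : ℝ) + (z.1 i : ℝ)), fun j => (z.2 j : ℝ)) ∈ S}.ncard : ℝ) -
        (MeasureTheory.volume S).toReal| * (1 + D / l) ≤ c * (1 + D / l) ^ (M + N) := by
  obtain ⟨c, hc, h⟩ := exists_convexCountBound (M + N)
  refine ⟨c, hc, ?_⟩
  intro L p l D hl hp hD S hS hSm hSb hSD
  let sh : (Fin M → ℝ) × (Fin N → ℝ) →ₗ[ℝ] (Fin M → ℝ) × (Fin N → ℝ) :=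
    (L.toLin' ∘ₗ LinearMap.snd ℝ _ _ + LinearMap.fst ℝ _ _).prod (LinearMap.snd ℝ _ _)
  have hsh : ∀ x, sh x = (fun i => ∑ j, L i j * x.2 j + x.1 i, x.2) := by
    intro x
    simp only [sh, LinearMap.prod_apply]
    rfl
  have hshm : Measurable sh := sh.continuous_of_finiteDimensional.measurable
  have hsm : Measurable (splitCoords M N) := (measurePreserving_splitCoords M N).measurable
  have hshvol : MeasureTheory.volume (sh ⁻¹' S) = MeasureTheory.volume S := by
    rw [MeasureTheory.Measure.volume_eq_prod, MeasureTheory.Measure.prod_apply_symm (hshm hSm),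
      MeasureTheory.Measure.prod_apply_symm hSm]
    refine MeasureTheory.lintegral_congr fun y => ?_
    rw [← MeasureTheory.measure_preimage_add MeasureTheory.volume (L.toLin' y)
      ((fun x => (x, y)) ⁻¹' S)]
    rfl
  let g := sh ∘ₗ splitCoords M N
  have hgvol : MeasureTheory.volume (g ⁻¹' S) = MeasureTheory.volume S := by
    rw [← hshvol, ← (measurePreserving_splitCoords M N).measure_preimage
      (hshm hSm).nullMeasurableSet]
    rfl
  have hginj : LinearMap.ker g = ⊥ := by
    rw [LinearMap.ker_eq_bot']
    intro x hx
    have hx' : sh (splitCoords M N x) = 0 := hx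
    rw [hsh] at hx'
    have h2 : ∀ j, x (Fin.natAdd M j) = 0 := fun j => congrFun (congrArg Prod.snd hx') j
    have h1 : ∀ i, x (Fin.castAdd N i) = 0 := by
      intro i
      have := congrFun (congrArg Prod.fst hx') i
      simpa [splitCoords, h2] using this
    ext k
    exact Fin.addCases h1 h2 k
  have hgb : Bornology.IsBounded (g ⁻¹' S) := by
    obtain ⟨K, -, hK⟩ := g.exists_antilipschitzWith hginj
    exact hK.isBounded_preimage hSb
  let E : (Fin (M + N) → ℤ) → (Fin M → ℤ) × (Fin N → ℤ) :=
    fun z => (fun i => z (Fin.castAdd N i), fun j => z (Fin.natAdd M j))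
  have hEinj : Function.Injective E := by
    intro a b hab
    ext k
    exact Fin.addCases (fun i => congrFun (congrArg Prod.fst hab) i)
      (fun j => congrFun (congrArg Prod.snd hab) j) k
  have hgE : ∀ z : Fin (M + N) → ℤ, g (fun i => (z i : ℝ)) =
      ((fun i => ∑ j, L i j * ((E z).2 j : ℝ) + ((E z).1 i : ℝ)), fun j => ((E z).2 j : ℝ)) :=
    fun z => hsh _
  have key := h (p.comp g) l D hl (by
      intro z hz
      rw [Seminorm.comp_apply, hgE]
      exact hp (E z) fun h0 => hz (hEinj (h0.trans rfl))) hD (g ⁻¹' S) (hS.linear_preimage g)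
    ((hshm.comp hsm) hSm) hgb (by
      intro x hx y hy
      rw [Seminorm.comp_apply, map_sub]
      exact hSD _ hx _ hy)
  rw [hgvol, ← Set.ncard_image_of_injective _ hEinj] at key
  convert key using 6
  ext z
  simp only [Set.mem_image, Set.mem_ofPred_eq, Set.mem_preimage, hgE]
  constructor
  · intro hz
    have hE : E (Fin.append z.1 z.2) = z := by
      ext <;> simp [E]
    exact ⟨Fin.append z.1 z.2, by rwa [hE], hE⟩
  · rintro ⟨y, hy, rfl⟩
    exact hy

theorem convex_setOf_le_prod {ι : Type*} [Fintype ι] {ε : ℝ} (hε : 0 < ε) :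
    Convex ℝ {v : ι → ℝ | (∀ i, 0 < v i) ∧ ε ≤ ∏ i, v i} := by
  rintro v ⟨hv, hvε⟩ w ⟨hw, hwε⟩ a b ha hb hab
  refine ⟨fun i => ?_, ?_⟩
  · exact (convex_Ioi (0 : ℝ)) (hv i) (hw i) ha hb hab
  · calc ε = ε ^ a * ε ^ b := by rw [← Real.rpow_add hε, hab, Real.rpow_one]
      _ ≤ (∏ i, v i) ^ a * (∏ i, w i) ^ b := by
        gcongr
        exact Real.rpow_nonneg (Finset.prod_nonneg fun i _ => (hv i).le) _
      _ = ∏ i, (v i ^ a * w i ^ b) := by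
        rw [Finset.prod_mul_distrib, Real.finsetProd_rpow _ _ fun i _ => (hv i).le,
          Real.finsetProd_rpow _ _ fun i _ => (hw i).le]
      _ ≤ ∏ i, (a • v + b • w) i := by
        refine Finset.prod_le_prod (fun i _ => ?_) fun i _ => ?_
        · have := hv i
          have := hw i
          positivity
        · exact Real.geom_mean_le_arith_mean2_weighted ha hb (hv i).le (hw i).le hab

/-- The logarithmic scale of `u` relative to `T`, truncated at `n`. -/
noncomputable def logScale (T : ℝ) (n : ℕ) (u : ℝ) : Fin (n + 1) :=
  ⟨min ⌊Real.log (T / |u|)⌋₊ n, by omega⟩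

theorem logScale_le_logScale {T : ℝ} (hT : 0 < T) (n : ℕ) {u v : ℝ} (hu : u ≠ 0)
    (huv : |u| ≤ |v|) : logScale T n v ≤ logScale T n u := by
  have hu' : 0 < |u| := abs_pos.2 hu
  have hv' : 0 < |v| := hu'.trans_le huv
  refine Fin.mk_le_mk.2 (min_le_min_right _ (Nat.floor_mono ?_))
  exact Real.log_le_log (by positivity) (by gcongr)

theorem abs_le_mul_exp_neg_logScale {T : ℝ} (hT : 0 < T) (n : ℕ) {u : ℝ} (hu : u ≠ 0)
    (huT : |u| ≤ T) : |u| ≤ T * Real.exp (-(logScale T n u : ℕ)) := by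
  have hu' : 0 < |u| := abs_pos.2 hu
  have h0 : 0 ≤ Real.log (T / |u|) := Real.log_nonneg (by rwa [le_div_iff₀ hu', one_mul])
  have h1 : ((logScale T n u : ℕ) : ℝ) ≤ Real.log (T / |u|) := by
    refine le_trans ?_ (Nat.floor_le h0)
    exact_mod_cast min_le_left _ _
  have h2 : Real.exp (logScale T n u : ℕ) ≤ T / |u| :=
    (Real.le_log_iff_exp_le (by positivity)).1 h1
  rw [le_div_iff₀ hu'] at h2
  rw [Real.exp_neg, ← div_eq_mul_inv, le_div_iff₀ (Real.exp_pos _)]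
  linarith

theorem mul_exp_neg_logScale_le_abs {T : ℝ} (hT : 0 < T) {n : ℕ} {u : ℝ} (hu : u ≠ 0)
    (h : (logScale T n u : ℕ) < n) : T * Real.exp (-((logScale T n u : ℕ) + 1)) ≤ |u| := by
  have hu' : 0 < |u| := abs_pos.2 hu
  have h1 : (logScale T n u : ℕ) = ⌊Real.log (T / |u|)⌋₊ := by
    simp only [logScale] at h ⊢
    omega
  have h2 : Real.log (T / |u|) ≤ (logScale T n u : ℕ) + 1 := by
    rw [h1]
    exact (Nat.lt_floor_add_one _).le
  have h3 := (Real.log_le_iff_le_exp (by positivity)).1 h2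
  rw [div_le_iff₀ hu'] at h3
  rw [Real.exp_neg, ← div_eq_mul_inv, div_le_iff₀ (Real.exp_pos _)]
  linarith

theorem ordConnected_sign_logScale {T : ℝ} (hT : 0 < T) (n : ℕ) (s : Bool) (k : Fin (n + 1)) :
    {u : ℝ | u ≠ 0 ∧ decide (0 < u) = s ∧ logScale T n u = k}.OrdConnected := by
  refine ⟨?_⟩
  rintro u ⟨hu, hus, huk⟩ w ⟨hw, hws, hwk⟩ v ⟨huv, hvw⟩
  cases s with
  | true =>
    simp only [decide_eq_true_eq] at hus hws
    have hv : 0 < v := hus.trans_le huv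
    refine ⟨hv.ne', by simpa using hv, le_antisymm ?_ ?_⟩
    · rw [← huk]
      exact logScale_le_logScale hT n hu (by rwa [abs_of_pos hus, abs_of_pos hv])
    · rw [← hwk]
      exact logScale_le_logScale hT n hv.ne' (by rwa [abs_of_pos hws, abs_of_pos hv])
  | false =>
    simp only [decide_eq_false_iff_not, not_lt] at hus hws
    have hv : v < 0 := hvw.trans_lt (lt_of_le_of_ne hws hw)
    refine ⟨hv.ne, by simpa using hv.le, le_antisymm ?_ ?_⟩
    · rw [← hwk]
      exact logScale_le_logScale hT n hw
        (by rw [abs_of_nonpos hws, abs_of_neg hv]; linarith)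
    · rw [← huk]
      exact logScale_le_logScale hT n hv.ne
        (by rw [abs_of_nonpos hus, abs_of_neg hv]; linarith)

theorem ordConnected_sign (s : Bool) : {u : ℝ | u ≠ 0 ∧ decide (0 < u) = s}.OrdConnected := by
  refine ⟨?_⟩
  rintro u ⟨hu, hus⟩ w ⟨hw, hws⟩ v ⟨huv, hvw⟩
  cases s with
  | true =>
    simp only [decide_eq_true_eq] at hus
    have hv : 0 < v := hus.trans_le huv
    exact ⟨hv.ne', by simpa using hv⟩
  | false =>
    simp only [decide_eq_false_iff_not, not_lt] at hws
    have hv : v < 0 := hvw.trans_lt (lt_of_le_of_ne hws hw)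
    exact ⟨hv.ne, by simpa using hv.le⟩

/-- The part of the hyperbolic region off the coordinate hyperplanes is partitioned into few
differences of convex subsets of boxes of volume comparable to `ε`. -/
theorem exists_convex_decomposition (m N : ℕ) {ε T Q : ℝ} (hε : 0 < ε) (hT : 0 < T)
    (hR : 1 ≤ Real.log (T ^ (m + 1) / ε)) :
    ∃ (ι : Type) (_ : Fintype ι) (lab : (Fin (m + 1) → ℝ) → ι)
      (U V : ι → Set ((Fin (m + 1) → ℝ) × (Fin N → ℝ))) (b : ι → Fin (m + 1) → ℝ),
      (Fintype.card ι : ℝ) ≤ 2 ^ (m + 1) * (3 * Real.log (T ^ (m + 1) / ε)) ^ m ∧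
      (∀ l i, 0 < b l i ∧ b l i ≤ T) ∧ (∀ l, ∏ i, b l i ≤ ε * Real.exp 1 ^ (m + 1)) ∧
      (∀ l, ∀ v ∈ U l, (∀ i, |v.1 i| ≤ b l i) ∧ ∀ j, |v.2 j| ≤ Q) ∧
      (∀ l, Convex ℝ (U l) ∧ MeasurableSet (U l)) ∧
      (∀ l, Convex ℝ (V l) ∧ MeasurableSet (V l)) ∧ (∀ l, V l ⊆ U l) ∧
      ∀ l v, v ∈ U l \ V l ↔ (((∏ i, |v.1 i|) < ε ∧ ∀ i, |v.1 i| ≤ T) ∧ (∀ j, |v.2 j| ≤ Q) ∧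
        ∀ i, v.1 i ≠ 0) ∧ lab v.1 = l := by
  set R := Real.log (T ^ (m + 1) / ε) with hRdef
  set n := ⌈R⌉₊ with hn
  have hnR : R ≤ n := Nat.le_ceil R
  have hnR' : (n : ℝ) < R + 1 := Nat.ceil_lt_add_one (by linarith)
  have hexpR : Real.exp R = T ^ (m + 1) / ε := Real.exp_log (by positivity)
  let ι := (Fin (m + 1) → Bool) × (Fin m → Fin (n + 1))
  let lab : (Fin (m + 1) → ℝ) → ι := fun x =>
    (fun i => decide (0 < x i), fun i => logScale T n (x i.succ))
  let h₀ : ι → ℝ := fun l =>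
    min T (ε / ∏ i, (T * Real.exp (-((l.2 i : ℕ) + 1))))
  let b : ι → Fin (m + 1) → ℝ := fun l =>
    Fin.cons (h₀ l) fun i => T * Real.exp (-(l.2 i : ℕ))
  let X : ι → Set (Fin (m + 1) → ℝ) := fun l => Set.univ.pi fun i =>
    Fin.cases (motive := fun _ => Set ℝ)
      ({u | u ≠ 0 ∧ decide (0 < u) = l.1 0} ∩ Set.Icc (-h₀ l) (h₀ l))
      (fun i => {u | u ≠ 0 ∧ decide (0 < u) = l.1 i.succ ∧ logScale T n u = l.2 i} ∩
        Set.Icc (-T) T) i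
  have hX : ∀ l x, x ∈ X l ↔ (∀ i, x i ≠ 0) ∧ lab x = l ∧ |x 0| ≤ h₀ l ∧
      ∀ i : Fin m, |x i.succ| ≤ T := by
    intro l x
    simp only [X, Set.mem_univ_pi]
    constructor
    · intro h
      have h0 := h 0
      have hs := fun i : Fin m => h i.succ
      simp only [Fin.cases_zero, Fin.cases_succ] at h0 hs
      exact ⟨Fin.cases h0.1.1 fun i => (hs i).1.1,
        Prod.ext (funext (Fin.cases h0.1.2 fun i => (hs i).1.2.1)) (funext fun i => (hs i).1.2.2),
        abs_le.2 h0.2, fun i => abs_le.2 (hs i).2⟩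
    · rintro ⟨hx0, rfl, hxh, hxT⟩
      refine Fin.cases ?_ fun i => ?_
      · exact ⟨⟨hx0 0, rfl⟩, abs_le.1 hxh⟩
      · exact ⟨⟨hx0 _, rfl, rfl⟩, abs_le.1 (hxT i)⟩
  let Y : Set (Fin N → ℝ) := Set.univ.pi fun _ => Set.Icc (-Q) Q
  have hY : ∀ y, y ∈ Y ↔ ∀ j, |y j| ≤ Q := by
    intro y
    simp only [Y, Set.mem_univ_pi, Set.mem_Icc, abs_le]
  have hXoc : ∀ l i, (Fin.cases (motive := fun _ => Set ℝ)
      ({u | u ≠ 0 ∧ decide (0 < u) = l.1 0} ∩ Set.Icc (-h₀ l) (h₀ l))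
      (fun i => {u | u ≠ 0 ∧ decide (0 < u) = l.1 i.succ ∧ logScale T n u = l.2 i} ∩
        Set.Icc (-T) T) i : Set ℝ).OrdConnected := by
    intro l i
    refine Fin.cases ?_ (fun i => ?_) i
    · exact (ordConnected_sign _).inter Set.ordConnected_Icc
    · exact (ordConnected_sign_logScale hT n _ _).inter Set.ordConnected_Icc
  have hXc : ∀ l, Convex ℝ (X l) := fun l => convex_pi fun i _ => (hXoc l i).convex
  have hXm : ∀ l, MeasurableSet (X l) := fun l =>
    MeasurableSet.univ_pi fun i => (hXoc l i).measurableSet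
  have hYc : Convex ℝ Y := convex_pi fun _ _ => convex_Icc _ _
  have hYm : MeasurableSet Y := MeasurableSet.univ_pi fun _ => measurableSet_Icc
  let U : ι → Set ((Fin (m + 1) → ℝ) × (Fin N → ℝ)) := fun l => X l ×ˢ Y
  let V : ι → Set ((Fin (m + 1) → ℝ) × (Fin N → ℝ)) := fun l =>
    U l ∩ {v | ε ≤ ∏ i, |v.1 i|}
  have hUc : ∀ l, Convex ℝ (U l) := fun l => (hXc l).prod hYc
  have hUm : ∀ l, MeasurableSet (U l) := fun l => (hXm l).prod hYm
  have hh₀ : ∀ l, 0 < h₀ l := fun l => lt_min hT (by positivity)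
  refine ⟨ι, inferInstance, lab, U, V, b, ?_, ?_, ?_, ?_, fun l => ⟨hUc l, hUm l⟩,
    fun l => ⟨?_, ?_⟩, fun l => Set.inter_subset_left, ?_⟩
  · simp only [ι, Fintype.card_prod, Fintype.card_pi, Fintype.card_bool, Fintype.card_fin,
      Finset.prod_const, Finset.card_univ]
    push_cast
    gcongr
    linarith
  · intro l i
    refine Fin.cases ?_ (fun i => ?_) i
    · exact ⟨hh₀ l, min_le_left _ _⟩
    · simp only [b, Fin.cons_succ]
      refine ⟨by positivity, mul_le_of_le_one_right hT.le ?_⟩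
      rw [Real.exp_le_one_iff]
      simp
  · intro l
    rw [Fin.prod_univ_succ]
    simp only [b, Fin.cons_zero, Fin.cons_succ]
    have h1 : ∏ i, (T * Real.exp (-((l.2 i : ℕ) + 1 : ℝ))) =
        (∏ i, T * Real.exp (-((l.2 i : ℕ) : ℝ))) * Real.exp (-1) ^ m := by
      rw [← Fin.prod_const, ← Finset.prod_mul_distrib]
      refine Finset.prod_congr rfl fun i _ => ?_
      rw [neg_add, Real.exp_add, mul_assoc]
    set P := ∏ i, T * Real.exp (-((l.2 i : ℕ) : ℝ)) with hP
    have hP0 : 0 < P := by positivity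
    have h2 : h₀ l ≤ ε / (P * Real.exp (-1) ^ m) := by
      rw [← h1]
      exact min_le_right _ _
    calc h₀ l * P ≤ ε / (P * Real.exp (-1) ^ m) * P := by gcongr
      _ = ε * Real.exp 1 ^ m := by
        rw [Real.exp_neg]
        field_simp
        rw [← mul_pow, one_div, inv_mul_cancel₀ (Real.exp_pos 1).ne', one_pow]
      _ ≤ ε * Real.exp 1 ^ (m + 1) := by
        gcongr
        · exact Real.one_le_exp zero_le_one
        · omega
  · rintro l ⟨x, y⟩ ⟨hx, hy⟩
    rw [hX] at hx
    obtain ⟨hx0, rfl, hxh, hxT⟩ := hx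
    refine ⟨?_, (hY y).1 hy⟩
    refine Fin.cases hxh fun i => ?_
    exact abs_le_mul_exp_neg_logScale hT n (hx0 _) (hxT i)
  · rintro v ⟨hv, hvε⟩ w ⟨hw, hwε⟩ a c ha hc hac
    refine ⟨hUc l hv hw ha hc hac, ?_⟩
    have hv1 := (hX l v.1).1 hv.1
    have hw1 := (hX l w.1).1 hw.1
    have h1 := (convex_setOf_le_prod hε
      (x := fun i => |v.1 i|) ⟨fun i => abs_pos.2 (hv1.1 i), hvε⟩
      (y := fun i => |w.1 i|) ⟨fun i => abs_pos.2 (hw1.1 i), hwε⟩ ha hc hac).2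
    refine h1.trans (le_of_eq (Finset.prod_congr rfl fun i _ => ?_))
    have hs : decide (0 < v.1 i) = decide (0 < w.1 i) := by
      have := hv1.2.1.trans hw1.2.1.symm
      exact congrFun (congrArg Prod.fst this) i
    rw [decide_eq_decide] at hs
    simp only [Pi.add_apply, Pi.smul_apply, smul_eq_mul, Prod.fst_add, Prod.smul_fst]
    by_cases h : 0 < v.1 i
    · have h' := hs.1 h
      rw [abs_of_pos h, abs_of_pos h', abs_of_nonneg (by positivity)]
    · have h' : ¬ 0 < w.1 i := fun h' => h (hs.2 h')
      push Not at h h'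
      rw [abs_of_nonpos h, abs_of_nonpos h', abs_of_nonpos (by nlinarith)]
      ring
  · refine (hUm l).inter (measurableSet_le measurable_const ?_)
    fun_prop
  · rintro l ⟨x, y⟩
    have hUV : (x, y) ∈ U l \ V l ↔ (x ∈ X l ∧ y ∈ Y) ∧ (∏ i, |x i|) < ε := by
      simp only [U, V, Set.mem_sdiff, Set.mem_inter_iff, Set.mem_prod, Set.mem_ofPred_eq]
      grind
    rw [hUV, hX, hY]
    constructor
    · rintro ⟨⟨⟨h0, hl, hh, hxT⟩, hy⟩, hlt⟩
      exact ⟨⟨⟨hlt, Fin.cases (hh.trans (min_le_left _ _)) hxT⟩, hy, h0⟩, hl⟩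
    · rintro ⟨⟨⟨hlt, hxT⟩, hy, h0⟩, hl⟩
      refine ⟨⟨⟨h0, hl, le_min (hxT 0) ?_, fun i => hxT _⟩, hy⟩, hlt⟩
      have hpos : 0 < ∏ i, (T * Real.exp (-((l.2 i : ℕ) + 1 : ℝ))) := by positivity
      rw [le_div_iff₀ hpos]
      by_cases hk : ∀ i, (l.2 i : ℕ) < n
      · refine le_trans ?_ hlt.le
        rw [Fin.prod_univ_succ (fun i => |x i|)]
        refine mul_le_mul_of_nonneg_left ?_ (abs_nonneg _)
        refine Finset.prod_le_prod (fun i _ => by positivity) fun i _ => ?_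
        have hki := hk i
        rw [← hl] at hki ⊢
        exact mul_exp_neg_logScale_le_abs hT (h0 _) hki
      · push Not at hk
        obtain ⟨i₀, hi₀⟩ := hk
        have h1 : ∏ i, (T * Real.exp (-((l.2 i : ℕ) + 1 : ℝ))) ≤ T ^ m * Real.exp (-R) := by
          rw [Finset.prod_mul_distrib, Fin.prod_const, ← Real.exp_sum]
          gcongr
          have h2 : -((l.2 i₀ : ℕ) + 1 : ℝ) ≥ ∑ i, -((l.2 i : ℕ) + 1 : ℝ) := by
            rw [Finset.sum_neg_distrib]
            refine neg_le_neg ?_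
            exact Finset.single_le_sum (f := fun i => ((l.2 i : ℕ) + 1 : ℝ))
              (fun i _ => by positivity) (Finset.mem_univ i₀)
          have h3 : (n : ℝ) ≤ (l.2 i₀ : ℕ) := by exact_mod_cast hi₀
          linarith
        calc |x 0| * _ ≤ T * (T ^ m * Real.exp (-R)) := by
              gcongr
              exact hxT 0
          _ = ε := by
            rw [Real.exp_neg, hexpR]
            field_simp
            ring

theorem distNearestInt_nonneg (x : ℝ) : 0 ≤ distNearestInt x := abs_nonneg _

theorem distNearestInt_le_abs_add (x : ℝ) (k : ℤ) : distNearestInt x ≤ |x + k| := by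
  simpa [distNearestInt] using round_le x (-k)

/-- The point `(Lq + p, q)` of the lattice attached to the matrix `L`. -/
def latticePoint {M N : ℕ} (L : Matrix (Fin M) (Fin N) ℝ) (z : (Fin M → ℤ) × (Fin N → ℤ)) :
    (Fin M → ℝ) × (Fin N → ℝ) :=
  (fun i => ∑ j, L i j * (z.2 j : ℝ) + (z.1 i : ℝ), fun j => (z.2 j : ℝ))

theorem one_le_norm_intCast {N : ℕ} {q : Fin N → ℤ} (hq : q ≠ 0) :
    1 ≤ ‖(fun j => (q j : ℝ))‖ := by
  obtain ⟨j, hj⟩ := Function.ne_iff.1 hq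
  refine le_trans ?_ (norm_le_pi_norm (fun j => (q j : ℝ)) j)
  rw [Real.norm_eq_abs]
  exact_mod_cast Int.one_le_abs hj

theorem abs_div_le_norm_iff {M N : ℕ} {b : Fin M → ℝ} {Q : ℝ} (hb : ∀ i, 0 < b i) (hQ : 0 < Q)
    (x : Fin M → ℝ) (y : Fin N → ℝ) {r : ℝ} (hr : 0 ≤ r) :
    ‖((fun i => (b i)⁻¹ * x i, fun j => Q⁻¹ * y j) : (Fin M → ℝ) × (Fin N → ℝ))‖ ≤ r ↔
      (∀ i, |x i| ≤ r * b i) ∧ ∀ j, |y j| ≤ r * Q := by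
  rw [Prod.norm_def, sup_le_iff, pi_norm_le_iff_of_nonneg hr, pi_norm_le_iff_of_nonneg hr]
  simp only [norm_mul, norm_inv, Real.norm_eq_abs, abs_of_pos hQ, fun i => abs_of_pos (hb i)]
  refine and_congr (forall_congr' fun i => ?_) (forall_congr' fun j => ?_)
  · rw [inv_mul_le_iff₀ (hb i), mul_comm]
  · rw [inv_mul_le_iff₀ hQ, mul_comm]

/-- A badly approximable lattice has no short nonzero vectors relative to a box of controlled
volume. -/
theorem le_norm_latticePoint {M N : ℕ} {φ : ℝ → ℝ} (hφ : ∀ x, 1 ≤ x → 0 < φ x ∧ φ x ≤ 1)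
    (hφ' : ∀ x y, 1 ≤ x → x ≤ y → φ y ≤ φ x) {L : Matrix (Fin M) (Fin N) ℝ}
    (hL : ∀ q : Fin N → ℤ, q ≠ 0 → φ ‖(fun j => (q j : ℝ))‖ ≤ ‖(fun j => (q j : ℝ))‖ ^ N *
      ∏ i, distNearestInt (∑ j, L i j * (q j : ℝ)))
    {ε T Q κ : ℝ} (hε : 0 < ε) (hT : 0 < T) (hQ : 1 ≤ Q) (hκ : 1 ≤ κ)
    (hκK : κ ^ (M + N) = ε * Q ^ N / φ Q) {b : Fin M → ℝ} (hb : ∀ i, 0 < b i ∧ b i ≤ T)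
    (hbε : ∏ i, b i ≤ ε * Real.exp 1 ^ M) {z : (Fin M → ℤ) × (Fin N → ℤ)} (hz : z ≠ 0) :
    (Real.exp 1 * (1 + T) * κ)⁻¹ ≤
      ‖((fun i => (b i)⁻¹ * (latticePoint L z).1 i, fun j => Q⁻¹ * (latticePoint L z).2 j) :
        (Fin M → ℝ) × (Fin N → ℝ))‖ := by
  set ν := ‖((fun i => (b i)⁻¹ * (latticePoint L z).1 i, fun j => Q⁻¹ * (latticePoint L z).2 j) :
        (Fin M → ℝ) × (Fin N → ℝ))‖ with hν
  have hν0 : 0 ≤ ν := norm_nonneg _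
  have he : 1 ≤ Real.exp 1 := Real.one_le_exp zero_le_one
  have hQ0 : 0 < Q := by linarith
  obtain ⟨hx, hy⟩ := (abs_div_le_norm_iff (fun i => (hb i).1) hQ0 _ _ hν0).1 hν.ge
  obtain ⟨hφQ, hφQ'⟩ := hφ Q hQ
  rw [inv_le_iff_one_le_mul₀ (by positivity)]
  have heκ : 1 ≤ Real.exp 1 * κ := one_le_mul_of_one_le_of_one_le he hκ
  by_cases hq : z.2 = 0
  · obtain ⟨i, hi⟩ : ∃ i, z.1 i ≠ 0 := by
      by_contra! h
      exact hz (Prod.ext (funext h) hq)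
    have h1 : (1 : ℝ) ≤ |(z.1 i : ℝ)| := by exact_mod_cast Int.one_le_abs hi
    have h2 := hx i
    simp only [latticePoint, hq, Pi.zero_apply, Int.cast_zero, mul_zero, Finset.sum_const_zero,
      zero_add] at h2
    have h3 : 1 ≤ ν * T := h1.trans (h2.trans (mul_le_mul_of_nonneg_left (hb i).2 hν0))
    calc (1 : ℝ) ≤ (ν * T) * (Real.exp 1 * κ) := one_le_mul_of_one_le_of_one_le h3 heκ
      _ ≤ (ν * (1 + T)) * (Real.exp 1 * κ) := by gcongr; linarith
      _ = _ := by ring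
  · have hn1 := one_le_norm_intCast hq
    suffices h : 1 ≤ ν * (Real.exp 1 * κ) by
      calc (1 : ℝ) ≤ ν * (Real.exp 1 * κ) * (1 + T) :=
            one_le_mul_of_one_le_of_one_le h (by linarith)
        _ = _ := by ring
    have hnν : ‖(fun j => (z.2 j : ℝ))‖ ≤ ν * Q :=
      (pi_norm_le_iff_of_nonneg (by positivity)).2 hy
    by_cases hnQ : ‖(fun j => (z.2 j : ℝ))‖ ≤ Q
    · have h1 : φ Q ≤ (ν * (Real.exp 1 * κ)) ^ (M + N) * φ Q := by
        calc φ Q ≤ φ ‖(fun j => (z.2 j : ℝ))‖ := hφ' _ _ hn1 hnQ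
          _ ≤ ‖(fun j => (z.2 j : ℝ))‖ ^ N *
              ∏ i, distNearestInt (∑ j, L i j * (z.2 j : ℝ)) := hL _ hq
          _ ≤ (ν * Q) ^ N * ∏ i, (ν * b i) := by
            refine mul_le_mul (by gcongr) (Finset.prod_le_prod
              (fun i _ => distNearestInt_nonneg _) fun i _ => ?_)
              (Finset.prod_nonneg fun i _ => distNearestInt_nonneg _) (by positivity)
            exact (distNearestInt_le_abs_add _ (z.1 i)).trans (hx i)
          _ = (ν * Q) ^ N * (ν ^ M * ∏ i, b i) := by
            rw [Finset.prod_mul_distrib, Finset.prod_const, Finset.card_univ, Fintype.card_fin]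
          _ ≤ (ν * Q) ^ N * (ν ^ M * (ε * Real.exp 1 ^ M)) := by gcongr
          _ = ν ^ (M + N) * Real.exp 1 ^ M * (ε * Q ^ N / φ Q) * φ Q := by
            field_simp
            ring
          _ ≤ ν ^ (M + N) * Real.exp 1 ^ (M + N) * (ε * Q ^ N / φ Q) * φ Q := by
            gcongr
            omega
          _ = (ν * (Real.exp 1 * κ)) ^ (M + N) * φ Q := by
            rw [← hκK]
            ring
      by_contra! h
      have hd : M + N ≠ 0 := by
        rintro hd
        obtain rfl : N = 0 := by omega
        exact hq (Subsingleton.elim _ _)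
      have h2 : (ν * (Real.exp 1 * κ)) ^ (M + N) < 1 := pow_lt_one₀ (by positivity) h hd
      nlinarith
    · push Not at hnQ
      have h1 : 1 ≤ ν := by
        by_contra! h
        nlinarith
      exact one_le_mul_of_one_le_of_one_le h1 heκ

theorem exists_abs_ncard_latticePoint_sub_volume_le (M N : ℕ) (hM : 1 ≤ M) :
    ∃ c : ℝ, 0 ≤ c ∧ ∀ φ : ℝ → ℝ, (∀ x, 1 ≤ x → 0 < φ x ∧ φ x ≤ 1) →
      (∀ x y, 1 ≤ x → x ≤ y → φ y ≤ φ x) → ∀ L : Matrix (Fin M) (Fin N) ℝ,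
      (∀ q : Fin N → ℤ, q ≠ 0 → φ ‖(fun j => (q j : ℝ))‖ ≤ ‖(fun j => (q j : ℝ))‖ ^ N *
        ∏ i, distNearestInt (∑ j, L i j * (q j : ℝ))) →
      ∀ ε T Q κ : ℝ, 0 < ε → 0 < T → 1 ≤ Q → 1 ≤ κ → κ ^ (M + N) = ε * Q ^ N / φ Q →
      ∀ b : Fin M → ℝ, (∀ i, 0 < b i ∧ b i ≤ T) → ∏ i, b i ≤ ε * Real.exp 1 ^ M →
      ∀ S : Set ((Fin M → ℝ) × (Fin N → ℝ)), Convex ℝ S → MeasurableSet S →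
      (∀ v ∈ S, (∀ i, |v.1 i| ≤ b i) ∧ ∀ j, |v.2 j| ≤ Q) →
      |({z | latticePoint L z ∈ S}.ncard : ℝ) - (MeasureTheory.volume S).toReal| ≤
        c * ((1 + T) ^ (M + N - 1) * κ ^ (M + N - 1)) := by
  obtain ⟨c, hc, H⟩ := exists_abs_ncard_sub_volume_le M N
  refine ⟨c * (1 + 2 * Real.exp 1) ^ (M + N - 1), by positivity, ?_⟩
  intro φ hφ hφ' L hL ε T Q κ hε hT hQ hκ hκK b hb hbε S hSc hSm hSb
  have hQ0 : 0 < Q := by linarith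
  have he : 1 ≤ Real.exp 1 := Real.one_le_exp zero_le_one
  let f : ((Fin M → ℝ) × (Fin N → ℝ)) →ₗ[ℝ] (Fin M → ℝ) × (Fin N → ℝ) :=
    (LinearMap.pi fun i => (b i)⁻¹ • LinearMap.proj i).prodMap
      (LinearMap.pi fun j => Q⁻¹ • LinearMap.proj j)
  let p : Seminorm ℝ ((Fin M → ℝ) × (Fin N → ℝ)) := (normSeminorm ℝ _).comp f
  have hp : ∀ v, p v = ‖((fun i => (b i)⁻¹ * v.1 i, fun j => Q⁻¹ * v.2 j) :
      (Fin M → ℝ) × (Fin N → ℝ))‖ := fun v => rfl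
  have hSbdd : Bornology.IsBounded S := by
    refine (Metric.isBounded_closedBall (x := (0 : (Fin M → ℝ) × (Fin N → ℝ)))
      (r := max T Q)).subset fun v hv => ?_
    rw [mem_closedBall_zero_iff, Prod.norm_def]
    refine max_le_max ?_ ?_
    · exact (pi_norm_le_iff_of_nonneg hT.le).2 fun i => ((hSb v hv).1 i).trans (hb i).2
    · exact (pi_norm_le_iff_of_nonneg hQ0.le).2 (hSb v hv).2
  have h := H L p (Real.exp 1 * (1 + T) * κ)⁻¹ 2 (by positivity)
    (fun z hz => le_norm_latticePoint hφ hφ' hL hε hT hQ hκ hκK hb hbε hz) zero_le_two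
    S hSc hSm hSbdd ?_
  · set A := 1 + 2 / (Real.exp 1 * (1 + T) * κ)⁻¹ with hA
    have hA0 : 0 < A := by positivity
    have hAle : A ≤ (1 + 2 * Real.exp 1) * ((1 + T) * κ) := by
      have h1 : 1 ≤ (1 + T) * κ := one_le_mul_of_one_le_of_one_le (by linarith) hκ
      rw [hA, div_inv_eq_mul]
      nlinarith
    have hd : M + N = (M + N - 1) + 1 := by omega
    rw [hd, pow_succ, ← mul_assoc] at h
    refine (le_of_mul_le_mul_right h hA0).trans ?_
    rw [← mul_pow, mul_assoc, ← mul_pow]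
    gcongr
  · intro x hx y hy
    rw [hp, abs_div_le_norm_iff (fun i => (hb i).1) hQ0 _ _ zero_le_two]
    refine ⟨fun i => ?_, fun j => ?_⟩
    · have h1 := abs_le.1 ((hSb x hx).1 i)
      have h2 := abs_le.1 ((hSb y hy).1 i)
      exact abs_le.2 ⟨by simp only [Prod.fst_sub, Pi.sub_apply]; linarith,
        by simp only [Prod.fst_sub, Pi.sub_apply]; linarith⟩
    · have h1 := abs_le.1 ((hSb x hx).2 j)
      have h2 := abs_le.1 ((hSb y hy).2 j)
      exact abs_le.2 ⟨by simp only [Prod.snd_sub, Pi.sub_apply]; linarith,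
        by simp only [Prod.snd_sub, Pi.sub_apply]; linarith⟩

theorem finite_setOf_latticePoint {M N : ℕ} (L : Matrix (Fin M) (Fin N) ℝ) (T Q : ℝ) :
    {z | (∀ i, |(latticePoint L z).1 i| ≤ T) ∧ ∀ j, |(latticePoint L z).2 j| ≤ Q}.Finite := by
  have hbox : ∀ (n : ℕ) (B : ℝ), {p : Fin n → ℤ | ∀ i, |(p i : ℝ)| ≤ B}.Finite := by
    intro n B
    refine (Set.Finite.pi' fun _ : Fin n => Set.finite_Icc (-⌊B⌋) ⌊B⌋).subset fun p hp i => ?_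
    have h := abs_le.1 (hp i)
    exact ⟨neg_le.1 (Int.le_floor.2 (by push_cast; linarith)), Int.le_floor.2 h.2⟩
  refine ((hbox M (T + ∑ i, ∑ j, |L i j| * Q)).prod (hbox N Q)).subset fun z hz => ?_
  refine ⟨fun i => ?_, hz.2⟩
  have h1 : |∑ j, L i j * (z.2 j : ℝ)| ≤ ∑ j, |L i j| * |(z.2 j : ℝ)| := by
    simpa only [abs_mul] using Finset.abs_sum_le_sum_abs (fun j => L i j * (z.2 j : ℝ)) _
  have h2 : ∑ j, |L i j| * |(z.2 j : ℝ)| ≤ ∑ j, |L i j| * Q :=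
    Finset.sum_le_sum fun j _ => mul_le_mul_of_nonneg_left (hz.2 j) (abs_nonneg _)
  have h3 : ∑ j, |L i j| * Q ≤ ∑ i, ∑ j, |L i j| * Q :=
    Finset.single_le_sum (f := fun i => ∑ j, |L i j| * Q) (fun i _ => Finset.sum_nonneg fun j _ =>
      mul_nonneg (abs_nonneg _) ((abs_nonneg _).trans (hz.2 j))) (Finset.mem_univ i)
  have h4 : |(z.1 i : ℝ)| ≤ |∑ j, L i j * (z.2 j : ℝ) + (z.1 i : ℝ)| +
      |∑ j, L i j * (z.2 j : ℝ)| := by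
    calc |(z.1 i : ℝ)| = |(∑ j, L i j * (z.2 j : ℝ) + (z.1 i : ℝ)) -
          ∑ j, L i j * (z.2 j : ℝ)| := by rw [add_sub_cancel_left]
      _ ≤ _ := abs_sub _ _
  have h5 : |∑ j, L i j * (z.2 j : ℝ) + (z.1 i : ℝ)| ≤ T := hz.1 i
  linarith

theorem ncard_setOf_abs_intCast_le (M : ℕ) {T : ℝ} (hT : 0 ≤ T) :
    ({p : Fin M → ℤ | ∀ i, |(p i : ℝ)| ≤ T}.ncard : ℝ) ≤ (2 * (1 + T)) ^ M := by
  have h : {p : Fin M → ℤ | ∀ i, |(p i : ℝ)| ≤ T} =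
      (Fintype.piFinset fun _ : Fin M => Finset.Icc (-⌊T⌋) ⌊T⌋ : Finset (Fin M → ℤ)) := by
    ext p
    simp only [Set.mem_ofPred_eq, Finset.mem_coe, Fintype.mem_piFinset, Finset.mem_Icc]
    refine forall_congr' fun i => ?_
    rw [abs_le, Int.le_floor, neg_le, neg_le (a := ⌊T⌋), Int.le_floor]
    push_cast
    rfl
  rw [h, Set.ncard_coe_finset, Fintype.card_piFinset, Finset.prod_const, Finset.card_univ,
    Fintype.card_fin, Int.card_Icc]
  push_cast
  gcongr
  have h0 : 0 ≤ ⌊T⌋ := Int.floor_nonneg.2 hT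
  have h1 : (((⌊T⌋ + 1 - -⌊T⌋).toNat : ℤ) : ℝ) = ⌊T⌋ + 1 - -⌊T⌋ := by
    rw [Int.toNat_of_nonneg (by omega)]
    push_cast
    ring
  have h2 := Int.floor_le T
  rw [Int.cast_natCast] at h1
  rw [h1]
  linarith

theorem volume_inter_setOf_ne_zero {M N : ℕ} (Z : Set ((Fin M → ℝ) × (Fin N → ℝ))) :
    MeasureTheory.volume (Z ∩ {v | ∀ i, v.1 i ≠ 0}) = MeasureTheory.volume Z := by
  refine MeasureTheory.measure_congr ?_
  have h : ∀ᵐ v : (Fin M → ℝ) × (Fin N → ℝ), ∀ i, v.1 i ≠ 0 := by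
    refine MeasureTheory.ae_all_iff.2 fun i => ?_
    exact MeasureTheory.Measure.quasiMeasurePreserving_fst.ae
      (MeasureTheory.Measure.ae_eval_ne
        (fun _ : Fin M => (MeasureTheory.volume : MeasureTheory.Measure ℝ)) i 0)
  filter_upwards [h] with v hv
  exact propext ⟨fun hh => hh.1, fun hh => ⟨hh, hv⟩⟩

theorem volume_real_le_of_subset_box {M N : ℕ} {b : Fin M → ℝ} {Q : ℝ} (hb : ∀ i, 0 < b i)
    (hQ : 0 < Q) {S : Set ((Fin M → ℝ) × (Fin N → ℝ))}
    (hS : ∀ v ∈ S, (∀ i, |v.1 i| ≤ b i) ∧ ∀ j, |v.2 j| ≤ Q) :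
    MeasureTheory.volume S ≠ ⊤ ∧
      (MeasureTheory.volume S).toReal ≤ (∏ i, (2 * b i)) * (2 * Q) ^ N := by
  have hsub : S ⊆ Set.Icc (fun i => -b i) b ×ˢ Set.Icc (fun _ => -Q) fun _ => Q := fun v hv =>
    ⟨⟨fun i => (abs_le.1 ((hS v hv).1 i)).1, fun i => (abs_le.1 ((hS v hv).1 i)).2⟩,
      fun j => (abs_le.1 ((hS v hv).2 j)).1, fun j => (abs_le.1 ((hS v hv).2 j)).2⟩
  have htop : MeasureTheory.volume (Set.Icc (fun i => -b i) b ×ˢ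
      Set.Icc (fun _ : Fin N => -Q) fun _ => Q) ≠ ⊤ :=
    (isCompact_Icc.prod isCompact_Icc).measure_lt_top.ne
  refine ⟨ne_top_of_le_ne_top htop (MeasureTheory.measure_mono hsub), ?_⟩
  refine (ENNReal.toReal_mono htop (MeasureTheory.measure_mono hsub)).trans (le_of_eq ?_)
  rw [MeasureTheory.Measure.volume_eq_prod, MeasureTheory.Measure.prod_prod, ENNReal.toReal_mul,
    Real.volume_Icc_pi_toReal fun i => (neg_lt_self (hb i)).le,
    Real.volume_Icc_pi_toReal fun _ => (neg_lt_self hQ).le, Finset.prod_const, Finset.card_univ,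
    Fintype.card_fin]
  simp only [sub_neg_eq_add, two_mul]

theorem measure_real_eq_sum_of_partition {E ι : Type*} [Fintype ι] [MeasurableSpace E]
    (μ : MeasureTheory.Measure E) {lab : E → ι} {U V : ι → Set E} {H : Set E}
    (hU : ∀ l, MeasurableSet (U l)) (hV : ∀ l, MeasurableSet (V l)) (hVU : ∀ l, V l ⊆ U l)
    (hfin : ∀ l, μ (U l) ≠ ⊤) (hH : ∀ l v, v ∈ U l \ V l ↔ v ∈ H ∧ lab v = l) :
    μ.real H = ∑ l, (μ.real (U l) - μ.real (V l)) := by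
  have hHU : H = ⋃ l, U l \ V l := by
    ext v
    simp only [Set.mem_iUnion, hH, exists_and_left, exists_eq', and_true]
  have hdisj : Pairwise (Function.onFun Disjoint fun l => U l \ V l) := by
    intro l k hlk
    refine Set.disjoint_left.2 fun v hl hk => hlk ?_
    rw [← ((hH l v).1 hl).2, ← ((hH k v).1 hk).2]
  rw [hHU, MeasureTheory.measureReal_iUnion_fintype hdisj (fun l => (hU l).diff (hV l))
    fun l => ne_top_of_le_ne_top (hfin l) (MeasureTheory.measure_mono Set.sdiff_subset)]
  exact Finset.sum_congr rfl fun l _ => MeasureTheory.measureReal_sdiff (hVU l) (hV l) (hfin l)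

theorem abs_ncard_sub_measure_real_le_of_partition {α E ι : Type*} [Fintype ι] [MeasurableSpace E]
    (μ : MeasureTheory.Measure E) (f : α → E) {lab : E → ι} {U V : ι → Set E} {H : Set E} {B : ℝ}
    (hU : ∀ l, MeasurableSet (U l)) (hV : ∀ l, MeasurableSet (V l)) (hVU : ∀ l, V l ⊆ U l)
    (hfin : ∀ l, μ (U l) ≠ ⊤) (hfin' : ∀ l, (f ⁻¹' U l).Finite)
    (hH : ∀ l v, v ∈ U l \ V l ↔ v ∈ H ∧ lab v = l)
    (hBU : ∀ l, |((f ⁻¹' U l).ncard : ℝ) - μ.real (U l)| ≤ B)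
    (hBV : ∀ l, |((f ⁻¹' V l).ncard : ℝ) - μ.real (V l)| ≤ B) :
    |((f ⁻¹' H).ncard : ℝ) - μ.real H| ≤ Fintype.card ι * (2 * B) := by
  let _ : MeasurableSpace α := ⊤
  have hreal : ∀ s : Set α, MeasureTheory.Measure.count.real s = s.ncard := by
    intro s
    rw [MeasureTheory.Measure.real,
      MeasureTheory.Measure.count_apply MeasurableSpace.measurableSet_top, Set.ncard]
    cases s.encard <;> simp
  have h1 := measure_real_eq_sum_of_partition MeasureTheory.Measure.count
    (lab := lab ∘ f) (U := fun l => f ⁻¹' U l) (V := fun l => f ⁻¹' V l) (H := f ⁻¹' H)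
    (fun _ => MeasurableSpace.measurableSet_top) (fun _ => MeasurableSpace.measurableSet_top)
    (fun l => Set.preimage_mono (hVU l))
    (fun l => (MeasureTheory.Measure.count_apply_lt_top.2 (hfin' l)).ne) fun l v => hH l (f v)
  simp only [hreal] at h1
  rw [h1, measure_real_eq_sum_of_partition μ hU hV hVU hfin hH, ← Finset.sum_sub_distrib]
  refine (Finset.abs_sum_le_sum_abs _ _).trans ?_
  rw [← nsmul_eq_mul, ← Finset.card_univ]
  refine Finset.sum_le_card_nsmul _ _ _ fun l _ => ?_
  have hu := abs_le.1 (hBU l)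
  have hv := abs_le.1 (hBV l)
  exact abs_le.2 ⟨by linarith, by linarith⟩

theorem le_prod_abs_latticePoint {M N : ℕ} {φ : ℝ → ℝ}
    (hφ' : ∀ x y, 1 ≤ x → x ≤ y → φ y ≤ φ x) {L : Matrix (Fin M) (Fin N) ℝ}
    (hL : ∀ q : Fin N → ℤ, q ≠ 0 → φ ‖(fun j => (q j : ℝ))‖ ≤ ‖(fun j => (q j : ℝ))‖ ^ N *
      ∏ i, distNearestInt (∑ j, L i j * (q j : ℝ)))
    {Q : ℝ} (hQ : 1 ≤ Q) {z : (Fin M → ℤ) × (Fin N → ℤ)} (hz : z.2 ≠ 0)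
    (hzQ : ∀ j, |(z.2 j : ℝ)| ≤ Q) : φ Q / Q ^ N ≤ ∏ i, |(latticePoint L z).1 i| := by
  have hn1 := one_le_norm_intCast hz
  have hnQ : ‖(fun j => (z.2 j : ℝ))‖ ≤ Q := (pi_norm_le_iff_of_nonneg (by linarith)).2 hzQ
  rw [div_le_iff₀' (by positivity)]
  calc φ Q ≤ φ ‖(fun j => (z.2 j : ℝ))‖ := hφ' _ _ hn1 hnQ
    _ ≤ ‖(fun j => (z.2 j : ℝ))‖ ^ N *
        ∏ i, distNearestInt (∑ j, L i j * (z.2 j : ℝ)) := hL _ hz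
    _ ≤ Q ^ N * ∏ i, |(latticePoint L z).1 i| :=
      mul_le_mul (by gcongr) (Finset.prod_le_prod (fun i _ => distNearestInt_nonneg _)
        fun i _ => distNearestInt_le_abs_add _ _)
        (Finset.prod_nonneg fun i _ => distNearestInt_nonneg _) (by positivity)

/-- **Proposition 1.2** (counting lattice points of `Λ_L` in the hyperbolic region `Z`).
If `L` is `φ`-semi multiplicatively badly approximable and `T^M/ε ≥ e^M`, then the number of
pairs `(p,q) ∈ ℤ^M × (ℤ^N \ {0})` with `∏ᵢ |Lᵢ(q)+pᵢ| < ε`, `|Lᵢ(q)+pᵢ| ≤ T` and `|qⱼ| ≤ Q`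
(which equals `#((Λ_L ∩ Z) \ C)`) differs from `Vol Z` by at most
`c (1+T)^{M+N-1} (log(T^M/ε))^{M-1} (ε Q^N/φ(Q))^{(M+N-1)/(M+N)}`. -/
theorem counting_weakly_admissible (M N : ℕ) (hM : 1 ≤ M) (hN : 1 ≤ N) :
    ∃ c : ℝ, 0 < c ∧
      ∀ φ : ℝ → ℝ, (∀ x, 1 ≤ x → 0 < φ x ∧ φ x ≤ 1) →
        (∀ x y, 1 ≤ x → x ≤ y → φ y ≤ φ x) →
      ∀ L : Matrix (Fin M) (Fin N) ℝ,
        (∀ q : Fin N → ℤ, q ≠ 0 →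
          φ ‖(fun j => (q j : ℝ))‖ ≤ ‖(fun j => (q j : ℝ))‖ ^ N *
            ∏ i, distNearestInt (∑ j, L i j * (q j : ℝ))) →
      ∀ ε T Q : ℝ, 0 < ε → 0 < T → 1 ≤ Q → Real.exp 1 ^ M ≤ T ^ M / ε →
        abs ((Set.ncard {pq : (Fin M → ℤ) × (Fin N → ℤ) | pq.2 ≠ 0 ∧
              (∏ i, abs ((∑ j, L i j * (pq.2 j : ℝ)) + (pq.1 i : ℝ))) < ε ∧
              (∀ i, abs ((∑ j, L i j * (pq.2 j : ℝ)) + (pq.1 i : ℝ)) ≤ T) ∧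
              (∀ j, abs ((pq.2 j : ℝ)) ≤ Q)} : ℝ) -
            (MeasureTheory.volume {v : (Fin M → ℝ) × (Fin N → ℝ) |
              ((∏ i, abs (v.1 i)) < ε ∧ ∀ i, abs (v.1 i) ≤ T) ∧ ∀ j, abs (v.2 j) ≤ Q}).toReal) ≤
          c * (1 + T) ^ (M + N - 1) * Real.log (T ^ M / ε) ^ (M - 1) *
            (ε * Q ^ N / φ Q) ^ (((M : ℝ) + N - 1) / ((M : ℝ) + N)) := by
  obtain ⟨m, rfl⟩ : ∃ m, M = m + 1 := ⟨M - 1, by omega⟩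
  obtain ⟨c₀, hc₀, hcount⟩ := exists_abs_ncard_latticePoint_sub_volume_le (m + 1) N hM
  refine ⟨2 ^ (m + 1) * 3 ^ m * (2 * c₀) + 2 ^ (m + 1) +
    2 ^ (m + 1) * 3 ^ m * (2 ^ (m + 1) * 2 ^ N * Real.exp 1 ^ (m + 1)), by positivity, ?_⟩
  intro φ hφ hφ' L hL ε T Q hε hT hQ hTε
  have hQ0 : 0 < Q := by linarith
  obtain ⟨hφQ, hφQ'⟩ := hφ Q hQ
  have hR : 1 ≤ Real.log (T ^ (m + 1) / ε) := by
    rw [Real.le_log_iff_exp_le (by positivity)]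
    refine le_trans ?_ hTε
    exact le_self_pow₀ (Real.one_le_exp zero_le_one) (by omega)
  obtain ⟨ι, _, lab, U, V, b, hcard, hb, hbε, hUb, hU, hV, hVU, hUV⟩ :=
    exists_convex_decomposition m N (Q := Q) hε hT hR
  set R := Real.log (T ^ (m + 1) / ε) with hRdef
  set K := ε * Q ^ N / φ Q with hK
  have hK0 : 0 < K := by positivity
  set κ := K ^ (1 / ((m + 1 : ℕ) + N : ℝ)) with hκ
  have hd0 : ((m + 1 : ℕ) + N : ℝ) ≠ 0 := by positivity
  have hκK : κ ^ (m + 1 + N) = K := by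
    rw [hκ, ← Real.rpow_natCast, ← Real.rpow_mul hK0.le, Nat.cast_add (m + 1) N,
      one_div_mul_cancel hd0, Real.rpow_one]
  have hκK' : K ^ ((((m + 1 : ℕ) : ℝ) + N - 1) / (((m + 1 : ℕ) : ℝ) + N)) =
      κ ^ (m + 1 + N - 1) := by
    rw [hκ, ← Real.rpow_natCast, ← Real.rpow_mul hK0.le, Nat.cast_sub (by omega)]
    congr 1
    push_cast
    ring
  have hκ0 : 0 < κ := Real.rpow_pos_of_pos hK0 _
  rw [hκK']
  set Z : Set ((Fin (m + 1) → ℝ) × (Fin N → ℝ)) :=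
    {v | ((∏ i, |v.1 i|) < ε ∧ ∀ i, |v.1 i| ≤ T) ∧ ∀ j, |v.2 j| ≤ Q} with hZ
  set A : Set ((Fin (m + 1) → ℤ) × (Fin N → ℤ)) := {pq | pq.2 ≠ 0 ∧
    (∏ i, |(∑ j, L i j * (pq.2 j : ℝ)) + (pq.1 i : ℝ)|) < ε ∧
    (∀ i, |(∑ j, L i j * (pq.2 j : ℝ)) + (pq.1 i : ℝ)| ≤ T) ∧ ∀ j, |(pq.2 j : ℝ)| ≤ Q} with hA
  set H := Z ∩ {v | ∀ i, v.1 i ≠ 0} with hH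
  have hHvol : (MeasureTheory.volume Z).toReal = MeasureTheory.volume.real H := by
    rw [MeasureTheory.Measure.real, hH, volume_inter_setOf_ne_zero]
  have hUV' : ∀ l v, v ∈ U l \ V l ↔ v ∈ H ∧ lab v.1 = l := by
    intro l v
    rw [hUV]
    exact ⟨fun h => ⟨⟨⟨h.1.1, h.1.2.1⟩, h.1.2.2⟩, h.2⟩, fun h => ⟨⟨h.1.1.1, h.1.1.2, h.1.2⟩, h.2⟩⟩
  have hUvol := fun l => volume_real_le_of_subset_box (fun i => (hb l i).1) hQ0 (hUb l)
  have hT1 : 1 ≤ (1 + T) ^ (m + 1 + N - 1) := one_le_pow₀ (by linarith)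
  have hR1 : 1 ≤ R ^ m := one_le_pow₀ hR
  rw [hHvol, Nat.add_sub_cancel m 1]
  rcases le_or_gt 1 K with hK1 | hK1
  · have hκ1 : 1 ≤ κ := Real.one_le_rpow hK1 (by positivity)
    have hκ1' : 1 ≤ κ ^ (m + 1 + N - 1) := one_le_pow₀ hκ1
    set P := latticePoint L ⁻¹' H with hP
    have hcountU : ∀ l, |((latticePoint L ⁻¹' U l).ncard : ℝ) - MeasureTheory.volume.real (U l)| ≤
        c₀ * ((1 + T) ^ (m + 1 + N - 1) * κ ^ (m + 1 + N - 1)) := fun l =>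
      hcount φ hφ hφ' L hL ε T Q κ hε hT hQ hκ1 hκK (b l) (hb l) (hbε l) (U l) (hU l).1 (hU l).2
        (hUb l)
    have hcountV : ∀ l, |((latticePoint L ⁻¹' V l).ncard : ℝ) - MeasureTheory.volume.real (V l)| ≤
        c₀ * ((1 + T) ^ (m + 1 + N - 1) * κ ^ (m + 1 + N - 1)) := fun l =>
      hcount φ hφ hφ' L hL ε T Q κ hε hT hQ hκ1 hκK (b l) (hb l) (hbε l) (V l) (hV l).1 (hV l).2
        fun v hv => hUb l v (hVU l hv)
    have h1 := abs_ncard_sub_measure_real_le_of_partition MeasureTheory.volume (latticePoint L)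
      (lab := fun v => lab v.1) (fun l => (hU l).2) (fun l => (hV l).2) hVU (fun l => (hUvol l).1)
      (fun l => (finite_setOf_latticePoint L T Q).subset fun z hz =>
        ⟨fun i => ((hUb l _ hz).1 i).trans (hb l i).2, (hUb l _ hz).2⟩) hUV' hcountU hcountV
    have hPfin : P.Finite := (finite_setOf_latticePoint L T Q).subset fun z hz =>
      ⟨hz.1.1.2, hz.1.2⟩
    have hAP : A ⊆ P := by
      rintro z ⟨hz0, hzε, hzT, hzQ⟩
      refine ⟨⟨⟨hzε, hzT⟩, hzQ⟩, fun i hi => ?_⟩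
      have h2 := le_prod_abs_latticePoint hφ' hL hQ hz0 hzQ
      rw [Finset.prod_eq_zero (Finset.mem_univ i) (by rw [hi, abs_zero])] at h2
      have : 0 < φ Q / Q ^ N := by positivity
      linarith
    have hdiff : ((P \ A).ncard : ℝ) ≤ (2 * (1 + T)) ^ (m + 1) := by
      refine le_trans ?_ (ncard_setOf_abs_intCast_le (m + 1) hT.le)
      have hfin : {p : Fin (m + 1) → ℤ | ∀ i, |(p i : ℝ)| ≤ T}.Finite :=
        ((finite_setOf_latticePoint (0 : Matrix (Fin (m + 1)) (Fin N) ℝ) T Q).image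
          Prod.fst).subset fun p hp => ⟨(p, 0), ⟨by simpa [latticePoint] using hp,
            by simp [latticePoint, hQ0.le]⟩, rfl⟩
      have hsub : P \ A ⊆ (fun p => (p, 0)) '' {p : Fin (m + 1) → ℤ | ∀ i, |(p i : ℝ)| ≤ T} := by
        rintro z ⟨hz, hzA⟩
        have hz0 : z.2 = 0 := by
          by_contra h
          exact hzA ⟨h, hz.1.1.1, hz.1.1.2, hz.1.2⟩
        refine ⟨z.1, fun i => ?_, Prod.ext rfl hz0.symm⟩
        simpa [latticePoint, hz0] using hz.1.1.2 i
      exact_mod_cast (Set.ncard_le_ncard hsub (hfin.image _)).trans (Set.ncard_image_le hfin)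
    have hsum : ((P \ A).ncard : ℝ) + A.ncard = P.ncard := by
      exact_mod_cast Set.ncard_sdiff_add_ncard_of_subset hAP hPfin
    have h2 : |(A.ncard : ℝ) - MeasureTheory.volume.real H| ≤
        |(P.ncard : ℝ) - MeasureTheory.volume.real H| + (P \ A).ncard := by
      rw [← hsum]
      have h3 := abs_le.1 (le_refl |((P \ A).ncard + A.ncard : ℝ) - MeasureTheory.volume.real H|)
      have h4 : (0 : ℝ) ≤ (P \ A).ncard := Nat.cast_nonneg _
      exact abs_le.2 ⟨by linarith, by linarith⟩
    calc |(A.ncard : ℝ) - MeasureTheory.volume.real H|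
        ≤ Fintype.card ι * (2 * (c₀ * ((1 + T) ^ (m + 1 + N - 1) * κ ^ (m + 1 + N - 1)))) +
          (2 * (1 + T)) ^ (m + 1) := by linarith
      _ ≤ 2 ^ (m + 1) * (3 * R) ^ m *
            (2 * (c₀ * ((1 + T) ^ (m + 1 + N - 1) * κ ^ (m + 1 + N - 1)))) +
          2 ^ (m + 1) * ((1 + T) ^ (m + 1 + N - 1) * (R ^ m * κ ^ (m + 1 + N - 1))) := by
        refine add_le_add (by gcongr) ?_
        rw [mul_pow]
        refine mul_le_mul_of_nonneg_left ?_ (by positivity)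
        calc (1 + T) ^ (m + 1) ≤ (1 + T) ^ (m + 1 + N - 1) :=
              pow_le_pow_right₀ (by linarith) (by omega)
          _ ≤ _ := le_mul_of_one_le_right (by positivity)
            (one_le_mul_of_one_le_of_one_le hR1 hκ1')
      _ = (2 ^ (m + 1) * 3 ^ m * (2 * c₀) + 2 ^ (m + 1)) * (1 + T) ^ (m + 1 + N - 1) * R ^ m *
          κ ^ (m + 1 + N - 1) := by ring
      _ ≤ _ := by
        gcongr ?_ * _ * _ * _
        exact le_add_of_nonneg_right (by positivity)
  · have hAempty : A = ∅ := by
      refine Set.eq_empty_of_forall_notMem ?_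
      rintro z ⟨hz0, hzε, -, hzQ⟩
      have h2 := (le_prod_abs_latticePoint hφ' hL hQ hz0 hzQ).trans_lt hzε
      rw [div_lt_iff₀ (by positivity)] at h2
      rw [hK, div_lt_one hφQ] at hK1
      linarith
    have hκ1 : κ ≤ 1 := Real.rpow_le_one hK0.le hK1.le (by positivity)
    have hεK : ε * Q ^ N ≤ κ ^ (m + 1 + N - 1) := by
      calc ε * Q ^ N ≤ K := le_div_self (by positivity) hφQ hφQ'
        _ = κ ^ (m + 1 + N) := hκK.symm
        _ ≤ κ ^ (m + 1 + N - 1) := pow_le_pow_of_le_one hκ0.le hκ1 (by omega)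
    rw [hAempty, Set.ncard_empty, Nat.cast_zero, zero_sub, abs_neg,
      abs_of_nonneg MeasureTheory.measureReal_nonneg,
      measure_real_eq_sum_of_partition MeasureTheory.volume (lab := fun v => lab v.1)
        (fun l => (hU l).2) (fun l => (hV l).2) hVU (fun l => (hUvol l).1) hUV']
    set B : ℝ := 2 ^ (m + 1) * 2 ^ N * Real.exp 1 ^ (m + 1) with hB
    calc ∑ l, (MeasureTheory.volume.real (U l) - MeasureTheory.volume.real (V l))
        ≤ Fintype.card ι * (B * (ε * Q ^ N)) := by
          rw [← nsmul_eq_mul, ← Finset.card_univ]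
          refine Finset.sum_le_card_nsmul _ _ _ fun l _ => ?_
          refine (sub_le_self _ MeasureTheory.measureReal_nonneg).trans ((hUvol l).2.trans ?_)
          rw [Finset.prod_mul_distrib, Finset.prod_const, Finset.card_univ, Fintype.card_fin]
          calc 2 ^ (m + 1) * (∏ i, b l i) * (2 * Q) ^ N
              ≤ 2 ^ (m + 1) * (ε * Real.exp 1 ^ (m + 1)) * (2 * Q) ^ N := by
                gcongr
                exact hbε l
            _ = B * (ε * Q ^ N) := by rw [hB]; ring
      _ ≤ 2 ^ (m + 1) * (3 * R) ^ m * (B * κ ^ (m + 1 + N - 1)) := by gcongr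
      _ = 2 ^ (m + 1) * 3 ^ m * B * 1 * R ^ m * κ ^ (m + 1 + N - 1) := by ring
      _ ≤ 2 ^ (m + 1) * 3 ^ m * B * (1 + T) ^ (m + 1 + N - 1) * R ^ m *
          κ ^ (m + 1 + N - 1) := by gcongr
      _ ≤ _ := by
        gcongr
        exact le_add_of_nonneg_left (by positivity)
end

section
/- Let 1 ≤ d < N be integers, A ∈ ℝ^{d×(N−d)}, α₀ ∈ ℝ^{N−d}, and let Ã ∈ ℝ^{(d+1)×(N−d)} be the matrix with first row α₀ and remaining rows those of A. If ω_m(Ã) = N(d+1) and ω'_m(Ã, N(d+1)) < 1 − 2(d+1), then the submanifold ℋ := {(x, x̃Ã) : x ∈ [0,1]^d} ⊂ ℝ^N is of Khintchine type for convergence: for every non-increasing ψ : [1,∞) → (0,1] with Σ_{q=1}^∞ ψ(q)^N < ∞, the d-dimensional Hausdorff measure of 𝒮_N(ψ) ∩ ℋ is 0. -/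
open scoped BigOperators

/-- the sup norm `|q|_∞` of an integer vector, as a real number -/
noncomputable def intSupNorm {k : ℕ} (q : Fin k → ℤ) : ℝ := ‖(fun j => (q j : ℝ))‖

/-- the multiplicative exponent `ω_m(L)` of a matrix `L` (with `sup ∅ = -∞`, via `EReal`) -/
noncomputable def multExp {M N : ℕ} (L : Matrix (Fin M) (Fin N) ℝ) : EReal :=
  sSup ((fun γ : ℝ => (γ : EReal)) '' {γ : ℝ |
    {q : Fin N → ℤ | q ≠ 0 ∧
      (∏ i, distNearestInt (∑ j, L i j * (q j : ℝ))) ≤ intSupNorm q ^ (-γ)}.Infinite})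

/-- the multiplicative logarithmic exponent `ω'_m(L, ω₀)` of a matrix `L` at `ω₀` -/
noncomputable def multLogExp {M N : ℕ} (L : Matrix (Fin M) (Fin N) ℝ) (ω₀ : ℝ) : EReal :=
  sSup ((fun γ : ℝ => (γ : EReal)) '' {γ : ℝ |
    {q : Fin N → ℤ | ¬ (∀ j, |q j| ≤ 1) ∧
      (∏ i, distNearestInt (∑ j, L i j * (q j : ℝ))) ≤
        intSupNorm q ^ (-ω₀) * Real.log (intSupNorm q) ^ (-γ)}.Infinite})

/-- the set `𝒮_N(ψ)` of simultaneously `ψ`-approximable points in `ℝ^N` -/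
def simultApprox (N : ℕ) (ψ : ℝ → ℝ) : Set (EuclideanSpace ℝ (Fin N)) :=
  {z | {q : ℕ | 0 < q ∧ ∀ i, distNearestInt ((q : ℝ) * z i) < ψ q}.Infinite}

theorem distNearestInt_le (x : ℝ) (n : ℤ) : distNearestInt x ≤ |x - n| := round_le x n

/-- the additive character `x ↦ exp (2πix)` -/
noncomputable def addChar (x : ℝ) : ℂ := Complex.exp ((2 * Real.pi * x : ℝ) * Complex.I)

theorem addChar_add (x y : ℝ) : addChar (x + y) = addChar x * addChar y := by
  rw [addChar, addChar, addChar, ← Complex.exp_add]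
  push_cast
  ring_nf

theorem norm_addChar (x : ℝ) : ‖addChar x‖ = 1 := Complex.norm_exp_ofReal_mul_I _

theorem addChar_sum {ι : Type*} (s : Finset ι) (f : ι → ℝ) :
    addChar (∑ i ∈ s, f i) = ∏ i ∈ s, addChar (f i) := by
  simp only [addChar, ← Complex.exp_sum, Finset.mul_sum, Complex.ofReal_sum, Finset.sum_mul]

theorem conj_addChar (x : ℝ) : (starRingEnd ℂ) (addChar x) = addChar (-x) := by
  rw [addChar, addChar, ← Complex.exp_conj, map_mul, Complex.conj_ofReal, Complex.conj_I]
  push_cast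
  ring_nf

theorem addChar_intCast (n : ℤ) : addChar n = 1 := by
  rw [addChar, Complex.exp_eq_one_iff]
  exact ⟨n, by push_cast; ring⟩

theorem addChar_sub_intCast (x : ℝ) (n : ℤ) : addChar (x - n) = addChar x := by
  have h := addChar_add (x - n) n
  rw [sub_add_cancel, addChar_intCast, mul_one] at h
  exact h.symm

theorem addChar_natCast_mul (n : ℕ) (x : ℝ) : addChar (n * x) = addChar x ^ n := by
  rw [addChar, addChar, ← Complex.exp_nat_mul]
  push_cast
  ring_nf

theorem addChar_re (x : ℝ) : (addChar x).re = Real.cos (2 * Real.pi * x) := by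
  rw [addChar, Complex.exp_ofReal_mul_I_re]

theorem half_le_addChar_re {x : ℝ} (n : ℤ) (hx : |x - n| ≤ 1 / 6) : 1 / 2 ≤ (addChar x).re := by
  rw [← addChar_sub_intCast x n, addChar_re, ← Real.cos_pi_div_three,
    ← Real.cos_abs (2 * Real.pi * (x - n))]
  rw [abs_mul, abs_of_pos (by positivity : (0 : ℝ) < 2 * Real.pi)]
  apply Real.cos_le_cos_of_nonneg_of_le_pi
  · positivity
  · linarith [Real.pi_pos]
  · nlinarith [Real.pi_pos]

theorem four_mul_abs_le_norm_addChar_sub_one {y : ℝ} (hy : |y| ≤ 1 / 2) :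
    4 * |y| ≤ ‖addChar y - 1‖ := by
  rw [addChar, mul_comm _ Complex.I, Complex.norm_exp_I_mul_ofReal_sub_one, norm_mul,
    Real.norm_eq_abs, Real.norm_eq_abs, abs_two]
  have h : |2 * Real.pi * y / 2| ≤ Real.pi / 2 := by
    rw [show 2 * Real.pi * y / 2 = Real.pi * y by ring, abs_mul, abs_of_pos Real.pi_pos]
    nlinarith [Real.pi_pos]
  have h2 := Real.mul_abs_le_abs_sin h
  rw [show 2 * Real.pi * y / 2 = Real.pi * y by ring, abs_mul, abs_of_pos Real.pi_pos] at h2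
  rw [show 2 * Real.pi * y / 2 = Real.pi * y by ring]
  have h3 : 2 / Real.pi * (Real.pi * |y|) = 2 * |y| := by
    field_simp
  linarith

/-- a summable majorant of the Fejér kernel on unit cells -/
noncomputable def cellWeight (k : ℤ) : ℝ := 4 / (1 + (k : ℝ) ^ 2)

theorem cellWeight_nonneg (k : ℤ) : 0 ≤ cellWeight k := by
  unfold cellWeight
  positivity

theorem summable_cellWeight : Summable cellWeight := by
  refine Summable.of_norm_bounded_eventually
    (g := fun k : ℤ => 4 * (1 / (k : ℝ) ^ 2))
    ((Real.summable_one_div_int_pow.mpr one_lt_two).mul_left 4) ?_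
  filter_upwards [(Set.finite_singleton (0 : ℤ)).compl_mem_cofinite] with k hk
  have hk0 : (k : ℝ) ≠ 0 := by exact_mod_cast hk
  rw [Real.norm_of_nonneg (cellWeight_nonneg k), cellWeight, mul_one_div]
  gcongr
  linarith

theorem norm_sum_addChar_sq_le (T : ℕ) (x : ℝ) :
    ‖∑ a ∈ Finset.range T, addChar (a * x)‖ ^ 2 ≤
      (T : ℝ) ^ 2 * cellWeight ⌊(T : ℝ) * (x - round x)⌋ := by
  set y := x - round x with hy
  have hsum : ∑ a ∈ Finset.range T, addChar (a * x) =
      ∑ a ∈ Finset.range T, addChar y ^ a := by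
    refine Finset.sum_congr rfl fun a _ => ?_
    rw [addChar_natCast_mul, hy, addChar_sub_intCast]
  rw [hsum]
  set Z := ‖∑ a ∈ Finset.range T, addChar y ^ a‖ with hZ
  have hZ0 : 0 ≤ Z := norm_nonneg _
  have hZT : Z ≤ T := by
    refine (norm_sum_le _ _).trans ?_
    simp [norm_addChar]
  have hZy : Z * (2 * |y|) ≤ 1 := by
    have h1 := four_mul_abs_le_norm_addChar_sub_one (y := y) (abs_sub_round x)
    have h2 : Z * ‖addChar y - 1‖ = ‖addChar y ^ T - 1‖ := by
      rw [hZ, ← norm_mul, geom_sum_mul]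
    have h3 : ‖addChar y ^ T - 1‖ ≤ 2 := by
      refine (norm_sub_le _ _).trans ?_
      simp [norm_addChar]
      norm_num
    nlinarith
  set k := ⌊(T : ℝ) * y⌋ with hk
  have hk1 : (k : ℝ) ≤ T * y := Int.floor_le _
  have hk2 : T * y < k + 1 := Int.lt_floor_add_one _
  have hT0 : (0 : ℝ) ≤ T := Nat.cast_nonneg T
  have hka : (k : ℝ) ^ 2 ≤ (|T * y| + 1) ^ 2 := by
    apply sq_le_sq'
    · linarith [neg_abs_le (T * y)]
    · linarith [le_abs_self (T * y)]
  rw [abs_mul, abs_of_nonneg hT0] at hka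
  have hsq : Z ^ 2 ≤ (T : ℝ) ^ 2 := pow_le_pow_left₀ hZ0 hZT 2
  have hprod : (Z * |y|) ^ 2 ≤ 1 / 4 := by
    have : Z * |y| ≤ 1 / 2 := by linarith
    nlinarith [mul_nonneg hZ0 (abs_nonneg y)]
  rw [cellWeight, ← mul_div_assoc, le_div_iff₀ (by positivity)]
  have e1 : Z ^ 2 * (1 + (k : ℝ) ^ 2) ≤ Z ^ 2 * (3 + 2 * (T * |y|) ^ 2) := by
    refine mul_le_mul_of_nonneg_left ?_ (sq_nonneg Z)
    nlinarith [sq_nonneg (T * |y| - 1)]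
  nlinarith [mul_le_mul_of_nonneg_left hprod (sq_nonneg (T : ℝ))]

/-- the Gram matrices `ZᴴZ` and `ZZᴴ` have the same Frobenius norm -/
theorem sum_norm_gram_sq_comm {α β : Type*} (s : Finset α) (t : Finset β) (z : α → β → ℂ) :
    ∑ a ∈ s, ∑ b ∈ s, ‖∑ h ∈ t, z a h * (starRingEnd ℂ) (z b h)‖ ^ 2 =
      ∑ h ∈ t, ∑ h' ∈ t, ‖∑ a ∈ s, z a h * (starRingEnd ℂ) (z a h')‖ ^ 2 := by
  have key : ∑ a ∈ s, ∑ b ∈ s, ∑ h ∈ t, ∑ h' ∈ t,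
        z a h * (starRingEnd ℂ) (z b h) * ((starRingEnd ℂ) (z a h') * z b h') =
      ∑ h ∈ t, ∑ h' ∈ t, ∑ a ∈ s, ∑ b ∈ s,
        z a h * (starRingEnd ℂ) (z b h) * ((starRingEnd ℂ) (z a h') * z b h') := by
    calc _ = ∑ a ∈ s, ∑ h ∈ t, ∑ b ∈ s, ∑ h' ∈ t,
          z a h * (starRingEnd ℂ) (z b h) * ((starRingEnd ℂ) (z a h') * z b h') :=
          Finset.sum_congr rfl fun a _ => Finset.sum_comm
      _ = ∑ h ∈ t, ∑ a ∈ s, ∑ b ∈ s, ∑ h' ∈ t,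
          z a h * (starRingEnd ℂ) (z b h) * ((starRingEnd ℂ) (z a h') * z b h') :=
          Finset.sum_comm
      _ = ∑ h ∈ t, ∑ a ∈ s, ∑ h' ∈ t, ∑ b ∈ s,
          z a h * (starRingEnd ℂ) (z b h) * ((starRingEnd ℂ) (z a h') * z b h') :=
          Finset.sum_congr rfl fun h _ => Finset.sum_congr rfl fun a _ => Finset.sum_comm
      _ = _ := Finset.sum_congr rfl fun h _ => Finset.sum_comm
  have hC : ((∑ a ∈ s, ∑ b ∈ s, ‖∑ h ∈ t, z a h * (starRingEnd ℂ) (z b h)‖ ^ 2 : ℝ) : ℂ) =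
      ((∑ h ∈ t, ∑ h' ∈ t, ‖∑ a ∈ s, z a h * (starRingEnd ℂ) (z a h')‖ ^ 2 : ℝ) : ℂ) := by
    push_cast
    simp only [← Complex.mul_conj', map_sum, map_mul, Complex.conj_conj, Finset.sum_mul_sum]
    rw [key]
    refine Finset.sum_congr rfl fun h _ => Finset.sum_congr rfl fun h' _ =>
      Finset.sum_congr rfl fun a _ => Finset.sum_congr rfl fun b _ => ?_
    ring
  exact_mod_cast hC

/-- a point set with at most one point in each cell has bounded Fejér mass -/
theorem sum_prod_norm_sum_addChar_le {β : Type*} {D : ℕ} (I : Finset β) (T : ℕ)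
    (y : β → Fin D → ℝ)
    (hsep : ∀ h ∈ I, ∀ h' ∈ I, h ≠ h' →
      ∃ i, 1 / (T : ℝ) ≤ distNearestInt (y h i - y h' i)) (hT : 0 < T) :
    ∑ h ∈ I, ∏ i, ‖∑ a ∈ Finset.range T, addChar (a * y h i)‖ ^ 2 ≤
      ((T : ℝ) ^ 2 * ∑' k, cellWeight k) ^ D := by
  have hT0 : (0 : ℝ) < T := by exact_mod_cast hT
  let cell : β → Fin D → ℤ := fun h i => ⌊(T : ℝ) * (y h i - round (y h i))⌋
  have hinj : Set.InjOn cell I := by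
    intro h hh h' hh' heq
    by_contra hne
    obtain ⟨i, hi⟩ := hsep h hh h' hh' hne
    have h1 := Int.abs_sub_lt_one_of_floor_eq_floor (congrFun heq i)
    rw [← mul_sub, abs_mul, abs_of_pos hT0] at h1
    have h2 := distNearestInt_le (y h i - y h' i) (round (y h i) - round (y h' i))
    push_cast at h2
    rw [show y h i - y h' i - (round (y h i) - round (y h' i) : ℝ) =
      y h i - round (y h i) - (y h' i - round (y h' i)) by ring] at h2
    have h3 := hi.trans h2
    rw [div_le_iff₀ hT0] at h3
    linarith
  calc ∑ h ∈ I, ∏ i, ‖∑ a ∈ Finset.range T, addChar (a * y h i)‖ ^ 2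
      ≤ ∑ h ∈ I, ∏ i, ((T : ℝ) ^ 2 * cellWeight (cell h i)) :=
        Finset.sum_le_sum fun h _ => Finset.prod_le_prod (fun i _ => by positivity)
          fun i _ => norm_sum_addChar_sq_le T (y h i)
    _ = ∑ k ∈ I.image cell, ∏ i, ((T : ℝ) ^ 2 * cellWeight (k i)) := by
        rw [Finset.sum_image hinj]
    _ ≤ ∑ k ∈ Fintype.piFinset fun i => (I.image cell).image fun k => k i,
          ∏ i, ((T : ℝ) ^ 2 * cellWeight (k i)) := by
        refine Finset.sum_le_sum_of_subset_of_nonneg ?_ fun k _ _ =>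
          Finset.prod_nonneg fun i _ => mul_nonneg (sq_nonneg _) (cellWeight_nonneg _)
        intro k hk
        exact Fintype.mem_piFinset.mpr fun i => Finset.mem_image_of_mem _ hk
    _ = ∏ i : Fin D, ∑ k ∈ (I.image cell).image fun k => k i, ((T : ℝ) ^ 2 * cellWeight k) := by
        rw [Finset.prod_univ_sum]
    _ ≤ ∏ i : Fin D, ((T : ℝ) ^ 2 * ∑' k, cellWeight k) := by
        refine Finset.prod_le_prod
          (fun i _ => Finset.sum_nonneg fun k _ => mul_nonneg (sq_nonneg _) (cellWeight_nonneg _))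
          fun i _ => ?_
        rw [← Finset.mul_sum]
        exact mul_le_mul_of_nonneg_left
          (summable_cellWeight.sum_le_tsum _ fun k _ => cellWeight_nonneg k) (sq_nonneg _)
    _ = _ := by simp

/-- a transference bound: if the linear forms given by the rows of `L` are not all small at any
small integer vector, then few integer vectors `n` make all the forms given by the columns small -/
theorem card_mul_le_of_separated {D m : ℕ} (L : Matrix (Fin D) (Fin m) ℝ) (Q T H : ℕ) (δ : ℝ)
    (hQT : Q < T) (hδ : (m : ℝ) * H * δ ≤ 1 / 6)
    (hsep : ∀ h : Fin m → ℤ, h ≠ 0 → (∀ j, |h j| ≤ H) →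
      ∃ i, 1 / (T : ℝ) ≤ distNearestInt (∑ j, L i j * (h j : ℝ)))
    (S : Finset (Fin D → ℕ)) (hSQ : ∀ n ∈ S, ∀ i, n i ≤ Q)
    (hSδ : ∀ n ∈ S, ∀ j, distNearestInt (∑ i, (n i : ℝ) * L i j) ≤ δ) :
    (S.card : ℝ) * ((T : ℝ) - Q) ^ D * ((H : ℝ) ^ m) ^ 2 ≤
      4 * (H : ℝ) ^ m * ((T : ℝ) ^ 2 * ∑' k, cellWeight k) ^ D := by
  classical
  set I : Finset (Fin m → ℕ) := Fintype.piFinset fun _ => Finset.range H with hI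
  set B : Finset (Fin D → ℕ) := Fintype.piFinset fun _ => Finset.range T with hB
  set B' : Finset (Fin D → ℕ) := Fintype.piFinset fun _ => Finset.range (T - Q) with hB'
  have hIcard : (I.card : ℝ) = (H : ℝ) ^ m := by simp [hI]
  set y : (Fin m → ℕ) → Fin D → ℝ := fun h i => ∑ j, L i j * (h j : ℝ) with hy
  set z : (Fin D → ℕ) → (Fin m → ℕ) → ℂ := fun a h => addChar (∑ i, (a i : ℝ) * y h i) with hz
  have hupper : ∑ h ∈ I, ∑ h' ∈ I, ‖∑ a ∈ B, z a h * (starRingEnd ℂ) (z a h')‖ ^ 2 ≤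
      (H : ℝ) ^ m * ((T : ℝ) ^ 2 * ∑' k, cellWeight k) ^ D := by
    rw [Finset.sum_comm, ← hIcard, ← nsmul_eq_mul]
    refine Finset.sum_le_card_nsmul _ _ _ fun h' hh' => ?_
    have hprod : ∀ h, ‖∑ a ∈ B, z a h * (starRingEnd ℂ) (z a h')‖ ^ 2 =
        ∏ i, ‖∑ a ∈ Finset.range T, addChar (a * (y h i - y h' i))‖ ^ 2 := by
      intro h
      rw [Finset.prod_pow, ← norm_prod, Finset.prod_univ_sum]
      congr 2
      refine Finset.sum_congr rfl fun a _ => ?_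
      rw [hz]
      simp only
      rw [conj_addChar, ← addChar_add, ← addChar_sum, ← sub_eq_add_neg, ← Finset.sum_sub_distrib]
      simp only [mul_sub]
    simp only [hprod]
    refine sum_prod_norm_sum_addChar_le I T (fun h i => y h i - y h' i) ?_ (by omega)
    intro h hh k hk hne
    obtain ⟨i, hi⟩ := hsep (fun j => (h j : ℤ) - k j)
      (fun h0 => hne (funext fun j => by have := congrFun h0 j; simp at this; omega))
      (fun j => by
        have h1 := Finset.mem_range.mp (Fintype.mem_piFinset.mp hh j)
        have h2 := Finset.mem_range.mp (Fintype.mem_piFinset.mp hk j)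
        rw [abs_le]
        omega)
    refine ⟨i, hi.trans (le_of_eq ?_)⟩
    congr 1
    simp only [hy, Int.cast_sub, Int.cast_natCast, mul_sub, Finset.sum_sub_distrib]
    ring
  have hlow : ∀ n ∈ S, ∀ b, ((H : ℝ) ^ m) ^ 2 / 4 ≤
      ‖∑ h ∈ I, z (b + n) h * (starRingEnd ℂ) (z b h)‖ ^ 2 := by
    intro n hn b
    have hterm : ∀ h ∈ I, 1 / 2 ≤ (z (b + n) h * (starRingEnd ℂ) (z b h)).re := by
      intro h hh
      have he : z (b + n) h * (starRingEnd ℂ) (z b h) =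
          addChar (∑ j, (h j : ℝ) * ∑ i, (n i : ℝ) * L i j) := by
        simp only [hz]
        rw [conj_addChar, ← addChar_add, ← sub_eq_add_neg, ← Finset.sum_sub_distrib]
        congr 1
        simp only [Pi.add_apply, Nat.cast_add, add_mul, add_sub_cancel_left]
        simp only [hy, Finset.mul_sum]
        rw [Finset.sum_comm]
        refine Finset.sum_congr rfl fun j _ => Finset.sum_congr rfl fun i _ => ?_
        ring
      rw [he]
      refine half_le_addChar_re (∑ j, (h j : ℤ) * round (∑ i, (n i : ℝ) * L i j)) ?_
      push_cast
      rw [← Finset.sum_sub_distrib]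
      refine (Finset.abs_sum_le_sum_abs _ _).trans ?_
      refine (Finset.sum_le_card_nsmul _ _ (H * δ) fun j _ => ?_).trans
        (by simpa [mul_assoc] using hδ)
      rw [← mul_sub, abs_mul, Nat.abs_cast]
      have h1 := Finset.mem_range.mp (Fintype.mem_piFinset.mp hh j)
      exact mul_le_mul (by exact_mod_cast h1.le) (hSδ n hn j) (abs_nonneg _) (Nat.cast_nonneg _)
    have hre : (H : ℝ) ^ m * (1 / 2) ≤ (∑ h ∈ I, z (b + n) h * (starRingEnd ℂ) (z b h)).re := by
      rw [Complex.re_sum, ← hIcard, ← nsmul_eq_mul]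
      exact Finset.card_nsmul_le_sum _ _ _ hterm
    have := pow_le_pow_left₀ (by positivity) (hre.trans (Complex.re_le_norm _)) 2
    linarith
  have hsum : ((S.card : ℝ) * ((T : ℝ) - Q) ^ D) * (((H : ℝ) ^ m) ^ 2 / 4) ≤
      ∑ a ∈ B, ∑ b ∈ B, ‖∑ h ∈ I, z a h * (starRingEnd ℂ) (z b h)‖ ^ 2 := by
    have hcard : ((S ×ˢ B').card : ℝ) = (S.card : ℝ) * ((T : ℝ) - Q) ^ D := by
      simp [hB', Nat.cast_sub hQT.le]
    rw [← hcard, ← nsmul_eq_mul]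
    calc _ ≤ ∑ p ∈ S ×ˢ B', ‖∑ h ∈ I, z (p.2 + p.1) h * (starRingEnd ℂ) (z p.2 h)‖ ^ 2 :=
          Finset.card_nsmul_le_sum _ _ _ fun p hp => hlow p.1 (Finset.mem_product.mp hp).1 p.2
      _ = ∑ p ∈ (S ×ˢ B').image (fun p => (p.2 + p.1, p.2)),
            ‖∑ h ∈ I, z p.1 h * (starRingEnd ℂ) (z p.2 h)‖ ^ 2 := by
          rw [Finset.sum_image]
          rintro ⟨n, b⟩ _ ⟨n', b'⟩ _ heq
          simp only [Prod.mk.injEq] at heq ⊢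
          obtain ⟨h1, rfl⟩ := heq
          exact ⟨add_left_cancel h1, rfl⟩
      _ ≤ ∑ p ∈ B ×ˢ B, ‖∑ h ∈ I, z p.1 h * (starRingEnd ℂ) (z p.2 h)‖ ^ 2 := by
          refine Finset.sum_le_sum_of_subset_of_nonneg ?_ fun _ _ _ => by positivity
          intro p hp
          obtain ⟨⟨n, b⟩, hnb, rfl⟩ := Finset.mem_image.mp hp
          obtain ⟨hn, hb⟩ := Finset.mem_product.mp hnb
          refine Finset.mem_product.mpr ⟨Fintype.mem_piFinset.mpr fun i => ?_,
            Fintype.mem_piFinset.mpr fun i => ?_⟩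
          all_goals
            have h1 := Finset.mem_range.mp (Fintype.mem_piFinset.mp hb i)
            have h2 := hSQ n hn i
            simp only [Finset.mem_range, Pi.add_apply] at h1 h2 ⊢
            omega
      _ = _ := Finset.sum_product _ _ _
  rw [sum_norm_gram_sq_comm] at hsum
  linarith [hsum.trans hupper]

theorem exists_rpow_mul_log_rpow_le {a τ : ℝ} (ha : 0 < a) (hτ : 0 < τ) :
    ∃ C : ℝ, 0 < C ∧ ∀ x R : ℝ, 2 ≤ x → x ≤ R →
      R ^ (-a) * Real.log R ^ τ ≤ C * (x ^ (-a) * Real.log x ^ τ) := by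
  have hlog2 : 0 < Real.log 2 := Real.log_pos one_lt_two
  set s := a / τ with hs
  have hs0 : 0 < s := div_pos ha hτ
  set K := 1 + 1 / (s * Real.log 2) with hK
  have hK0 : 0 < K := by positivity
  refine ⟨K ^ τ, Real.rpow_pos_of_pos hK0 τ, fun x R hx hxR => ?_⟩
  have hx0 : 0 < x := by linarith
  have hR0 : 0 < R := by linarith
  have hlogx : Real.log 2 ≤ Real.log x := Real.log_le_log two_pos hx
  have hratio : 1 ≤ R / x := by rwa [le_div_iff₀ hx0, one_mul]
  have hpow1 : 1 ≤ (R / x) ^ s := Real.one_le_rpow hratio hs0.le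
  have hlogR : Real.log R ≤ K * ((R / x) ^ s * Real.log x) := by
    have h1 : Real.log (R / x) ≤ (R / x) ^ s / s := Real.log_le_rpow_div (by positivity) hs0
    rw [Real.log_div hR0.ne' hx0.ne'] at h1
    have h2 : (R / x) ^ s / s ≤ 1 / (s * Real.log 2) * ((R / x) ^ s * Real.log x) := by
      rw [show 1 / (s * Real.log 2) * ((R / x) ^ s * Real.log x) =
        (R / x) ^ s / s * (Real.log x / Real.log 2) by field_simp]
      exact le_mul_of_one_le_right (by positivity) (by rwa [le_div_iff₀ hlog2, one_mul])
    have h3 : Real.log x ≤ (R / x) ^ s * Real.log x :=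
      le_mul_of_one_le_left (by linarith) hpow1
    rw [hK, add_mul, one_mul]
    linarith
  have hlogR0 : 0 ≤ Real.log R := Real.log_nonneg (by linarith)
  calc R ^ (-a) * Real.log R ^ τ
      ≤ R ^ (-a) * (K * ((R / x) ^ s * Real.log x)) ^ τ := by gcongr
    _ = K ^ τ * (x ^ (-a) * Real.log x ^ τ) := by
        rw [Real.mul_rpow hK0.le (mul_nonneg (by positivity) (by linarith)),
          Real.mul_rpow (by positivity) (by linarith),
          ← Real.rpow_mul (by positivity), hs, div_mul_cancel₀ _ hτ.ne',
          Real.div_rpow hR0.le hx0.le, Real.rpow_neg hR0.le, Real.rpow_neg hx0.le]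
        have := Real.rpow_pos_of_pos hR0 a
        have := Real.rpow_pos_of_pos hx0 a
        field_simp

theorem two_le_intSupNorm {n : ℕ} {q : Fin n → ℤ} (hq : ¬ ∀ j, |q j| ≤ 1) :
    2 ≤ intSupNorm q := by
  push Not at hq
  obtain ⟨j, hj⟩ := hq
  have h1 : ‖(q j : ℝ)‖ ≤ intSupNorm q := norm_le_pi_norm (fun j => (q j : ℝ)) j
  have h2 : (2 : ℝ) ≤ |(q j : ℝ)| := by exact_mod_cast hj
  exact h2.trans h1

theorem finite_of_multLogExp_lt {M n : ℕ} {L : Matrix (Fin M) (Fin n) ℝ} {a τ : ℝ}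
    (h : multLogExp L a < ((-τ : ℝ) : EReal)) :
    {q : Fin n → ℤ | ¬ (∀ j, |q j| ≤ 1) ∧
      (∏ i, distNearestInt (∑ j, L i j * (q j : ℝ))) ≤
        intSupNorm q ^ (-a) * Real.log (intSupNorm q) ^ τ}.Finite := by
  by_contra hinf
  refine absurd h (not_lt.mpr (le_sSup ⟨-τ, ?_, rfl⟩))
  simpa using hinf

theorem finite_intVec_abs_le_one (n : ℕ) : {q : Fin n → ℤ | ∀ j, |q j| ≤ 1}.Finite := by
  refine (Set.finite_Icc (fun _ : Fin n => (-1 : ℤ)) (fun _ => 1)).subset fun q hq => ?_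
  exact ⟨fun j => (abs_le.mp (hq j)).1, fun j => (abs_le.mp (hq j)).2⟩

theorem prod_distNearestInt_pos {M n : ℕ} {L : Matrix (Fin M) (Fin n) ℝ} {a τ : ℝ}
    (h : multLogExp L a < ((-τ : ℝ) : EReal)) {q : Fin n → ℤ} (hq : q ≠ 0) :
    0 < ∏ i, distNearestInt (∑ j, L i j * (q j : ℝ)) := by
  refine lt_of_le_of_ne (Finset.prod_nonneg fun i _ => distNearestInt_nonneg _) fun h0 => ?_
  obtain ⟨i, -, hi⟩ := Finset.prod_eq_zero_iff.mp h0.symm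
  obtain ⟨j₀, hj₀⟩ := Function.ne_iff.mp hq
  have hj₀' : q j₀ ≠ 0 := hj₀
  have hmul : ∀ k : ℕ, distNearestInt (∑ j, L i j * ((((k : ℤ) + 2) * q j : ℤ) : ℝ)) = 0 := by
    intro k
    refine le_antisymm ?_ (distNearestInt_nonneg _)
    refine (distNearestInt_le _ (((k : ℤ) + 2) * round (∑ j, L i j * (q j : ℝ)))).trans ?_
    have hi' : (∑ j, L i j * (q j : ℝ)) = round (∑ j, L i j * (q j : ℝ)) :=
      sub_eq_zero.mp (abs_eq_zero.mp hi)
    push_cast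
    rw [← hi', Finset.mul_sum, ← Finset.sum_sub_distrib, Finset.sum_eq_zero, abs_zero]
    intro j _
    ring
  have hinj : Function.Injective fun (k : ℕ) (j : Fin n) => ((k : ℤ) + 2) * q j := by
    intro k k' hkk
    have := mul_right_cancel₀ hj₀' (congrFun hkk j₀)
    omega
  refine Set.infinite_range_of_injective hinj ((finite_of_multLogExp_lt h).subset ?_)
  rintro _ ⟨k, rfl⟩
  have hbig : ¬ ∀ j, |((k : ℤ) + 2) * q j| ≤ 1 := by
    intro hall
    have h1 := hall j₀
    have h2 := Int.one_le_abs hj₀'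
    rw [abs_mul, abs_of_nonneg (by omega : (0 : ℤ) ≤ (k : ℤ) + 2)] at h1
    nlinarith
  refine ⟨hbig, ?_⟩
  rw [Finset.prod_eq_zero (Finset.mem_univ i) (hmul k)]
  have h2 := two_le_intSupNorm hbig
  have h3 : 0 ≤ Real.log (intSupNorm fun j => ((k : ℤ) + 2) * q j) := Real.log_nonneg (by linarith)
  positivity

theorem exists_le_prod_distNearestInt {M n : ℕ} {L : Matrix (Fin M) (Fin n) ℝ} {a τ : ℝ}
    (ha : 0 < a) (hτ : 0 < τ) (h : multLogExp L a < ((-τ : ℝ) : EReal)) :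
    ∃ c : ℝ, 0 < c ∧ ∀ q : Fin n → ℤ, q ≠ 0 → ∀ R : ℝ, 2 ≤ R → intSupNorm q ≤ R →
      c * (R ^ (-a) * Real.log R ^ τ) ≤ ∏ i, distNearestInt (∑ j, L i j * (q j : ℝ)) := by
  obtain ⟨C, hC, hCle⟩ := exists_rpow_mul_log_rpow_le ha hτ
  set P : (Fin n → ℤ) → ℝ := fun q => ∏ i, distNearestInt (∑ j, L i j * (q j : ℝ)) with hP
  obtain ⟨c₁, hc₁, hc₁le⟩ : ∃ c₁ : ℝ, 0 < c₁ ∧ ∀ q : Fin n → ℤ, q ≠ 0 →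
      ((∀ j, |q j| ≤ 1) ∨ P q ≤ intSupNorm q ^ (-a) * Real.log (intSupNorm q) ^ τ) →
        c₁ ≤ P q := by
    have hfin := ((finite_intVec_abs_le_one n).union (finite_of_multLogExp_lt h)).inter_of_left
      {q | q ≠ 0}
    obtain hE | hE := Set.eq_empty_or_nonempty
      (({q : Fin n → ℤ | ∀ j, |q j| ≤ 1} ∪ {q : Fin n → ℤ | ¬ (∀ j, |q j| ≤ 1) ∧
        P q ≤ intSupNorm q ^ (-a) * Real.log (intSupNorm q) ^ τ}) ∩ {q | q ≠ 0})
    · refine ⟨1, one_pos, fun q hq hor => ?_⟩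
      have : q ∈ (∅ : Set (Fin n → ℤ)) := by
        rw [← hE]
        by_cases hs : ∀ j, |q j| ≤ 1
        · exact ⟨Or.inl hs, hq⟩
        · exact ⟨Or.inr ⟨hs, hor.resolve_left hs⟩, hq⟩
      exact this.elim
    · obtain ⟨q₀, hq₀, hmin⟩ := Set.exists_min_image _ P hfin hE
      refine ⟨P q₀, prod_distNearestInt_pos h hq₀.2, fun q hq hor => hmin q ?_⟩
      by_cases hs : ∀ j, |q j| ≤ 1
      · exact ⟨Or.inl hs, hq⟩
      · exact ⟨Or.inr ⟨hs, hor.resolve_left hs⟩, hq⟩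
  set F : ℝ → ℝ := fun x => x ^ (-a) * Real.log x ^ τ with hF
  have hFpos : ∀ x, 2 ≤ x → 0 < F x := fun x hx =>
    mul_pos (Real.rpow_pos_of_pos (by linarith) _)
      (Real.rpow_pos_of_pos (Real.log_pos (by linarith)) _)
  have hF2 := hFpos 2 le_rfl
  refine ⟨min (c₁ / (C * F 2)) (1 / C), by positivity, fun q hq R hR hqR => ?_⟩
  have hFR := hFpos R hR
  change _ * F R ≤ P q
  by_cases hor : (∀ j, |q j| ≤ 1) ∨ P q ≤ F (intSupNorm q)
  · calc min (c₁ / (C * F 2)) (1 / C) * F R ≤ c₁ / (C * F 2) * (C * F 2) :=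
          mul_le_mul (min_le_left _ _) (hCle 2 R le_rfl hR) hFR.le (by positivity)
      _ = c₁ := div_mul_cancel₀ _ (by positivity)
      _ ≤ P q := hc₁le q hq hor
  · push Not at hor
    have h2 : 2 ≤ intSupNorm q := two_le_intSupNorm (by push Not; exact hor.1)
    calc min (c₁ / (C * F 2)) (1 / C) * F R ≤ 1 / C * (C * F (intSupNorm q)) :=
          mul_le_mul (min_le_right _ _) (hCle _ R h2 hqR) hFR.le (by positivity)
      _ = F (intSupNorm q) := by field_simp
      _ ≤ P q := hor.2.le

/-- separation at the critical scale `(2 ^ k * k ^ s) ^ (1 / N)` with `s = (2d + 1) / (d + 1)` -/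
theorem exists_separation {d N n : ℕ} (hN : 0 < N)
    {L : Matrix (Fin (d + 1)) (Fin n) ℝ}
    (h : multLogExp L ((N : ℝ) * ((d : ℝ) + 1)) < ((1 - 2 * ((d : ℝ) + 1) : ℝ) : EReal)) :
    ∃ M : ℕ, 3 ≤ M ∧ ∀ (k : ℕ) (R : ℝ), 1 ≤ k → 2 ≤ R →
      R ^ N = 2 ^ k * (k : ℝ) ^ ((2 * (d : ℝ) + 1) / (d + 1)) →
      ∀ q : Fin n → ℤ, q ≠ 0 → (∀ j, |(q j : ℝ)| ≤ R) →
        ∃ i, 1 / ((M * 2 ^ k : ℕ) : ℝ) ≤ distNearestInt (∑ j, L i j * (q j : ℝ)) := by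
  rw [show (1 - 2 * ((d : ℝ) + 1)) = -(2 * (d : ℝ) + 1) by ring] at h
  have hN0 : (0 : ℝ) < N := by exact_mod_cast hN
  obtain ⟨c, hc, hcle⟩ := exists_le_prod_distNearestInt (a := (N : ℝ) * ((d : ℝ) + 1))
    (τ := 2 * (d : ℝ) + 1) (by positivity) (by positivity) h
  have hlog2 : 0 < Real.log 2 := Real.log_pos one_lt_two
  set c' := c * (Real.log 2 / N) ^ (2 * (d : ℝ) + 1) with hc'
  have hc'0 : 0 < c' := by positivity
  obtain ⟨M₀, hM₀⟩ := exists_nat_gt (1 / c')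
  refine ⟨M₀ + 3, by omega, fun k R hk hR hRN q hq hqR => ?_⟩
  by_contra! hsmall
  have hk0 : (0 : ℝ) < k := by exact_mod_cast hk
  have hk1 : (1 : ℝ) ≤ k := by exact_mod_cast hk
  have hR0 : 0 < R := by linarith
  set s := (2 * (d : ℝ) + 1) / (d + 1) with hs
  have hsup : intSupNorm q ≤ R := (pi_norm_le_iff_of_nonneg hR0.le).mpr hqR
  have h1 := hcle q hq R hR hsup
  have hRpow : R ^ (-((N : ℝ) * ((d : ℝ) + 1))) =
      ((2 ^ k : ℝ) ^ (d + 1))⁻¹ * ((k : ℝ) ^ (2 * (d : ℝ) + 1))⁻¹ := by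
    rw [Real.rpow_neg hR0.le, Real.rpow_mul hR0.le, Real.rpow_natCast, hRN,
      Real.mul_rpow (by positivity) (by positivity), ← Real.rpow_mul hk0.le, hs,
      div_mul_cancel₀ _ (by positivity), mul_inv]
    congr 2
    exact_mod_cast Real.rpow_natCast (2 ^ k : ℝ) (d + 1)
  have hlogR : Real.log 2 / N * k ≤ Real.log R := by
    have h2 : (N : ℝ) * Real.log R = k * Real.log 2 + s * Real.log k := by
      rw [← Real.log_pow, hRN, Real.log_mul (by positivity) (by positivity), Real.log_pow,
        Real.log_rpow hk0]
    have h3 : 0 ≤ s * Real.log k := mul_nonneg (by positivity) (Real.log_nonneg hk1)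
    rw [div_mul_eq_mul_div, div_le_iff₀ hN0]
    linarith
  have h2 : c' * ((2 ^ k : ℝ) ^ (d + 1))⁻¹ ≤
      ∏ i, distNearestInt (∑ j, L i j * (q j : ℝ)) := by
    refine le_trans ?_ h1
    calc c' * ((2 ^ k : ℝ) ^ (d + 1))⁻¹
        = c * (R ^ (-((N : ℝ) * ((d : ℝ) + 1))) *
            (Real.log 2 / N * k) ^ (2 * (d : ℝ) + 1)) := by
          rw [hRpow, hc', Real.mul_rpow (by positivity) (by positivity)]
          have := Real.rpow_pos_of_pos hk0 (2 * (d : ℝ) + 1)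
          field_simp
      _ ≤ _ := by gcongr
  have h3 : ∏ i, distNearestInt (∑ j, L i j * (q j : ℝ)) ≤
      (1 / (((M₀ + 3) * 2 ^ k : ℕ) : ℝ)) ^ (d + 1) := by
    refine (Finset.prod_le_prod (fun i _ => distNearestInt_nonneg _)
      fun i _ => (hsmall i).le).trans (le_of_eq ?_)
    simp
  have h4 : (1 / (((M₀ + 3) * 2 ^ k : ℕ) : ℝ)) ^ (d + 1) =
      (1 / ((M₀ : ℝ) + 3)) ^ (d + 1) * ((2 ^ k : ℝ) ^ (d + 1))⁻¹ := by
    push_cast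
    rw [← inv_pow, ← mul_pow]
    congr 1
    field_simp
  have h5 : c' ≤ (1 / ((M₀ : ℝ) + 3)) ^ (d + 1) := by
    have := h2.trans (h3.trans_eq h4)
    exact le_of_mul_le_mul_right this (by positivity)
  have h6 : (1 / ((M₀ : ℝ) + 3)) ^ (d + 1) ≤ 1 / ((M₀ : ℝ) + 3) := by
    refine pow_le_of_le_one (by positivity) ?_ (by omega)
    rw [div_le_one (by positivity)]
    linarith [(Nat.cast_nonneg M₀ : (0 : ℝ) ≤ M₀)]
  have h7 := h5.trans h6
  rw [le_div_iff₀ (by positivity)] at h7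
  rw [div_lt_iff₀ hc'0] at hM₀
  linarith

open MeasureTheory in
/-- the points of the unit cube having an approximation with denominator in `[2 ^ k, 2 ^ (k + 1))`
have measure at most a constant times `2 ^ k * p ^ d / H ^ m` -/
theorem volume_le_of_separated {d m : ℕ} (L : Matrix (Fin (d + 1)) (Fin m) ℝ) (k M H : ℕ)
    (B p : ℝ) (hB : ∀ j, 1 + ∑ i, |L i j| ≤ B) (hp : 0 ≤ p) (hM : 3 ≤ M) (hH : 0 < H)
    (hHp : (m : ℝ) * H * (B * p) ≤ 1 / 6)
    (hsep : ∀ h : Fin m → ℤ, h ≠ 0 → (∀ j, |h j| ≤ H) →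
      ∃ i, 1 / ((M * 2 ^ k : ℕ) : ℝ) ≤ distNearestInt (∑ j, L i j * (h j : ℝ)))
    (E : Set (Fin d → ℝ))
    (hE : ∀ x ∈ E, (∀ i, x i ∈ Set.Icc (0 : ℝ) 1) ∧ ∃ q : ℕ, 2 ^ k ≤ q ∧ q < 2 ^ (k + 1) ∧
      (∀ i, distNearestInt (q * x i) ≤ p) ∧
      ∀ j, distNearestInt (q * Matrix.vecMul (Fin.cons 1 x) L j) ≤ p) :
    volume E ≤ ENNReal.ofReal
      (4 * ((M : ℝ) ^ 2 * ∑' k, cellWeight k) ^ (d + 1) * 2 ^ d * (2 ^ k * p ^ d / (H : ℝ) ^ m)) := by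
  classical
  set S : Finset (Fin (d + 1) → ℕ) :=
    (Fintype.piFinset fun _ => Finset.range (2 ^ (k + 1) + 1)).filter
      fun n => ∀ j, distNearestInt (∑ i, (n i : ℝ) * L i j) ≤ B * p with hS
  have hcover : E ⊆ ⋃ n ∈ S,
      Metric.closedBall (fun i : Fin d => (n i.succ : ℝ) / n 0) (p / 2 ^ k) := by
    intro x hx
    obtain ⟨hx01, q, hq1, hq2, hqx, hqL⟩ := hE x hx
    have hq0 : (0 : ℝ) < q := by
      have : 0 < q := lt_of_lt_of_le (by positivity) hq1
      exact_mod_cast this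
    set a : Fin d → ℤ := fun i => round ((q : ℝ) * x i) with ha
    have ha0 : ∀ i, 0 ≤ a i := fun i => by
      have h1 : 0 ≤ (q : ℝ) * x i := mul_nonneg hq0.le (hx01 i).1
      rw [ha]
      simp only [round_eq]
      exact Int.floor_nonneg.mpr (by linarith)
    have haq : ∀ i, a i ≤ q := fun i => by
      have h1 : (q : ℝ) * x i ≤ q := mul_le_of_le_one_right hq0.le (hx01 i).2
      rw [ha]
      simp only [round_eq]
      refine Int.lt_add_one_iff.mp (Int.floor_lt.mpr ?_)
      push_cast
      linarith
    have hax : ∀ i, |(q : ℝ) * x i - a i| ≤ p := hqx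
    set n : Fin (d + 1) → ℕ := Fin.cons q fun i => (a i).toNat with hn
    have hn0 : n 0 = q := rfl
    have hns : ∀ i : Fin d, ((n i.succ : ℕ) : ℝ) = a i := fun i => by
      have : ((a i).toNat : ℤ) = a i := Int.toNat_of_nonneg (ha0 i)
      simp only [hn, Fin.cons_succ]
      exact_mod_cast congrArg (Int.cast : ℤ → ℝ) this
    refine Set.mem_iUnion₂.mpr ⟨n, Finset.mem_filter.mpr ⟨?_, fun j => ?_⟩, ?_⟩
    · refine Fintype.mem_piFinset.mpr fun i => Finset.mem_range.mpr ?_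
      refine Fin.cases ?_ (fun i => ?_) i
      · rw [hn0]
        omega
      · have h1 := haq i
        simp only [hn, Fin.cons_succ]
        omega
    · have hdiff : ∑ i, (n i : ℝ) * L i j - q * Matrix.vecMul (Fin.cons 1 x) L j =
          ∑ i : Fin d, ((a i : ℝ) - q * x i) * L i.succ j := by
        simp only [Matrix.vecMul, dotProduct, Fin.sum_univ_succ, Fin.cons_zero, Fin.cons_succ, hns,
          hn0, mul_add, Finset.mul_sum, sub_mul, Finset.sum_sub_distrib]
        ring_nf
      have hbound : |∑ i : Fin d, ((a i : ℝ) - q * x i) * L i.succ j| ≤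
          p * ∑ i, |L i j| := by
        refine (Finset.abs_sum_le_sum_abs _ _).trans ?_
        rw [Fin.sum_univ_succ, mul_add, Finset.mul_sum]
        refine le_add_of_nonneg_of_le (by positivity) (Finset.sum_le_sum fun i _ => ?_)
        rw [abs_mul, abs_sub_comm]
        exact mul_le_mul_of_nonneg_right (hax i) (abs_nonneg _)
      set Y := (q : ℝ) * Matrix.vecMul (Fin.cons 1 x) L j with hY
      refine (distNearestInt_le _ (round Y)).trans ?_
      have h1 : |Y - round Y| ≤ p := hqL j
      rw [show ∑ i, (n i : ℝ) * L i j - (round Y : ℤ) =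
        (∑ i, (n i : ℝ) * L i j - Y) + (Y - round Y) by ring]
      refine (abs_add_le _ _).trans ?_
      rw [hdiff]
      nlinarith [hB j]
    · refine Metric.mem_closedBall.mpr ((dist_pi_le_iff (by positivity)).mpr fun i => ?_)
      rw [hns, hn0, Real.dist_eq, show x i - (a i : ℝ) / q = (q * x i - a i) / q by field_simp,
        abs_div, abs_of_pos hq0]
      have : (2 ^ k : ℝ) ≤ q := by exact_mod_cast hq1
      exact div_le_div₀ hp (hax i) (by positivity) this
  have hcard := card_mul_le_of_separated L (2 ^ (k + 1)) (M * 2 ^ k) H (B * p)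
    (by rw [pow_succ]; nlinarith [Nat.two_pow_pos k]) hHp hsep S
    (fun n hn i => by
      have := Finset.mem_range.mp (Fintype.mem_piFinset.mp (Finset.mem_filter.mp hn).1 i)
      omega)
    (fun n hn => (Finset.mem_filter.mp hn).2)
  have hH0 : (0 : ℝ) < H := by exact_mod_cast hH
  set W := ∑' k, cellWeight k with hW
  have hM3 : (3 : ℝ) ≤ M := by exact_mod_cast hM
  have hcard' : (S.card : ℝ) ≤ 4 * ((M : ℝ) ^ 2 * W) ^ (d + 1) * (2 ^ k) ^ (d + 1) / (H : ℝ) ^ m := by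
    have hgap : (2 ^ k : ℝ) ≤ ((M * 2 ^ k : ℕ) : ℝ) - ((2 ^ (k + 1) : ℕ) : ℝ) := by
      push_cast
      rw [pow_succ]
      nlinarith [(by positivity : (0 : ℝ) < 2 ^ k)]
    have h1 : (S.card : ℝ) * (2 ^ k) ^ (d + 1) * ((H : ℝ) ^ m) ^ 2 ≤
        4 * (H : ℝ) ^ m * (((M * 2 ^ k : ℕ) : ℝ) ^ 2 * W) ^ (d + 1) := by
      refine le_trans ?_ hcard
      gcongr
    have h2 : 4 * (H : ℝ) ^ m * (((M * 2 ^ k : ℕ) : ℝ) ^ 2 * W) ^ (d + 1) =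
        (4 * ((M : ℝ) ^ 2 * W) ^ (d + 1) * (2 ^ k) ^ (d + 1)) *
          ((2 ^ k) ^ (d + 1) * (H : ℝ) ^ m) := by
      push_cast
      rw [show ((M : ℝ) * 2 ^ k) ^ 2 * W = (M ^ 2 * W) * 2 ^ k * 2 ^ k by ring, mul_pow, mul_pow]
      ring
    rw [le_div_iff₀ (by positivity)]
    refine le_of_mul_le_mul_right (a := (2 ^ k : ℝ) ^ (d + 1) * (H : ℝ) ^ m) ?_ (by positivity)
    linarith
  calc volume E
      ≤ volume (⋃ n ∈ S,
          Metric.closedBall (fun i : Fin d => (n i.succ : ℝ) / n 0) (p / 2 ^ k)) :=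
        measure_mono hcover
    _ ≤ ∑ n ∈ S, volume (Metric.closedBall (fun i : Fin d => (n i.succ : ℝ) / n 0) (p / 2 ^ k)) :=
        measure_biUnion_finset_le _ _
    _ = ENNReal.ofReal (S.card * (2 * (p / 2 ^ k)) ^ d) := by
        rw [ENNReal.ofReal_mul (by positivity), ENNReal.ofReal_natCast, ← nsmul_eq_mul,
          ← Finset.sum_const]
        refine Finset.sum_congr rfl fun n _ => ?_
        rw [Real.volume_pi_closedBall _ (by positivity), Fintype.card_fin]
    _ ≤ _ := by
        refine ENNReal.ofReal_le_ofReal ?_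
        calc (S.card : ℝ) * (2 * (p / 2 ^ k)) ^ d
            ≤ 4 * ((M : ℝ) ^ 2 * W) ^ (d + 1) * (2 ^ k) ^ (d + 1) / (H : ℝ) ^ m *
              (2 * (p / 2 ^ k)) ^ d := by gcongr
          _ = _ := by
              rw [mul_pow 2, div_pow, pow_succ (2 ^ k : ℝ) d]
              field_simp

theorem summable_two_pow_mul_of_antitone {N : ℕ} {ψ : ℝ → ℝ}
    (hψ : ∀ x, 1 ≤ x → 0 < ψ x ∧ ψ x ≤ 1) (hmono : ∀ x y, 1 ≤ x → x ≤ y → ψ y ≤ ψ x)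
    (hsum : Summable fun q : ℕ => ψ ((q : ℝ) + 1) ^ N) :
    Summable fun k : ℕ => (2 : ℝ) ^ k * ψ (2 ^ k) ^ N := by
  have hone : ∀ n : ℕ, (1 : ℝ) ≤ max (n : ℝ) 1 := fun n => le_max_right _ _
  have h := (summable_condensed_iff_of_nonneg (f := fun n : ℕ => ψ (max (n : ℝ) 1) ^ N)
    (fun n => pow_nonneg (hψ _ (hone n)).1.le N)
    (fun a b _ hab => pow_le_pow_left₀ (hψ _ (hone b)).1.le
      (hmono _ _ (hone a) (max_le_max_right _ (by exact_mod_cast hab))) N)).mpr ?_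
  · refine h.congr fun k => ?_
    have : (1 : ℝ) ≤ 2 ^ k := one_le_pow₀ one_le_two
    simp [max_eq_left this]
  · refine (summable_nat_add_iff 1).mp (hsum.congr fun q => ?_)
    have : (1 : ℝ) ≤ (q : ℝ) + 1 := by linarith [(Nat.cast_nonneg q : (0 : ℝ) ≤ q)]
    simp only [Nat.cast_add, Nat.cast_one, max_eq_left this]

open MeasureTheory Filter in
theorem volume_approx_eq_zero {d N m : ℕ} (hd : 1 ≤ d) (hm : 1 ≤ m) (hN : N = d + m)
    (L : Matrix (Fin (d + 1)) (Fin m) ℝ)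
    (h : multLogExp L ((N : ℝ) * ((d : ℝ) + 1)) < ((1 - 2 * ((d : ℝ) + 1) : ℝ) : EReal))
    {ψ : ℝ → ℝ} (hψ : ∀ x, 1 ≤ x → 0 < ψ x ∧ ψ x ≤ 1)
    (hmono : ∀ x y, 1 ≤ x → x ≤ y → ψ y ≤ ψ x)
    (hsum : Summable fun q : ℕ => ψ ((q : ℝ) + 1) ^ N) :
    volume {x : Fin d → ℝ | (∀ i, x i ∈ Set.Icc (0 : ℝ) 1) ∧
      {q : ℕ | 0 < q ∧ (∀ i, distNearestInt (q * x i) < ψ q) ∧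
        ∀ j, distNearestInt (q * Matrix.vecMul (Fin.cons 1 x) L j) < ψ q}.Infinite} = 0 := by
  have hN1 : 0 < N := by omega
  have hNne : N ≠ 0 := hN1.ne'
  obtain ⟨M, hM, hsep⟩ := exists_separation hN1 h
  have hd0 : (0 : ℝ) < d := by exact_mod_cast hd
  have hm0 : (1 : ℝ) ≤ m := by exact_mod_cast hm
  set s := (2 * (d : ℝ) + 1) / (d + 1) with hs
  have hs1 : 1 < s := by
    rw [hs, lt_div_iff₀ (by positivity)]
    linarith
  set B := 1 + ∑ j, ∑ i, |L i j| with hB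
  have hB1 : 1 ≤ B := le_add_of_nonneg_right (by positivity)
  have hBj : ∀ j, 1 + ∑ i, |L i j| ≤ B := fun j => by
    have : ∑ i, |L i j| ≤ ∑ j, ∑ i, |L i j| := Finset.single_le_sum (f := fun j => ∑ i, |L i j|)
      (fun _ _ => Finset.sum_nonneg fun _ _ => abs_nonneg _) (Finset.mem_univ j)
    linarith
  set c := 1 / (6 * m * B) with hc
  have hc0 : 0 < c := by positivity
  have hc6 : c ≤ 1 / 6 := by
    rw [hc]
    gcongr
    nlinarith
  set v : ℕ → ℝ := fun k => 2 ^ k * ψ (2 ^ k) ^ N + (k : ℝ) ^ (-s) with hv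
  have hvsum : Summable v := (summable_two_pow_mul_of_antitone hψ hmono hsum).add
    (Real.summable_nat_rpow.mpr (by linarith))
  have hone : ∀ k : ℕ, (1 : ℝ) ≤ 2 ^ k := fun k => one_le_pow₀ one_le_two
  have hψk : ∀ k : ℕ, 0 < ψ (2 ^ k) := fun k => (hψ _ (hone k)).1
  have hv0 : ∀ k, 0 < v k := fun k => by
    have := hψk k
    positivity
  set p : ℕ → ℝ := fun k => (v k / 2 ^ k) ^ (1 / (N : ℝ)) with hp
  have hp0 : ∀ k, 0 < p k := fun k => Real.rpow_pos_of_pos (div_pos (hv0 k) (by positivity)) _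
  have hpN : ∀ k, p k ^ N = v k / 2 ^ k := fun k => by
    rw [hp]
    simp only [one_div]
    exact Real.rpow_inv_natCast_pow (div_pos (hv0 k) (by positivity)).le hNne
  have hψp : ∀ k, ψ (2 ^ k) ≤ p k := fun k => by
    rw [← pow_le_pow_iff_left₀ (hψk k).le (hp0 k).le hNne, hpN, le_div_iff₀ (by positivity), hv,
      mul_comm]
    exact le_add_of_nonneg_right (by positivity)
  obtain ⟨K₀, hK₀⟩ : ∃ K₀, ∀ k ≥ K₀, v k ≤ c ^ N :=
    eventually_atTop.mp (hvsum.tendsto_atTop_zero.eventually_le_const (by positivity))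
  have hpc : ∀ k ≥ K₀, p k ≤ c := fun k hk => by
    rw [← pow_le_pow_iff_left₀ (hp0 k).le hc0.le hNne, hpN]
    exact (div_le_self (hv0 k).le (hone k)).trans (hK₀ k hk)
  set P : ℕ → (Fin d → ℝ) → Prop := fun k x => (K₀ ≤ k ∧ 1 ≤ k) ∧
    (∀ i, x i ∈ Set.Icc (0 : ℝ) 1) ∧ ∃ q : ℕ, 2 ^ k ≤ q ∧ q < 2 ^ (k + 1) ∧
      (∀ i, distNearestInt (q * x i) ≤ p k) ∧
      ∀ j, distNearestInt (q * Matrix.vecMul (Fin.cons 1 x) L j) ≤ p k with hP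
  set C := 4 * ((M : ℝ) ^ 2 * ∑' k, cellWeight k) ^ (d + 1) * 2 ^ d with hC
  have hC0 : 0 ≤ C := by
    have : 0 ≤ ∑' k, cellWeight k := tsum_nonneg cellWeight_nonneg
    positivity
  have hvol : ∀ k, volume {x | P k x} ≤ ENNReal.ofReal (C * (2 / c) ^ m * v k) := by
    intro k
    by_cases hk : K₀ ≤ k ∧ 1 ≤ k
    swap
    · have : {x | P k x} = ∅ := Set.eq_empty_of_forall_notMem fun x hx => hk hx.1
      rw [this, measure_empty]
      exact zero_le
    have hk0 : (0 : ℝ) < k := by exact_mod_cast hk.2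
    have hpk := hp0 k
    have hpck := hpc k hk.1
    set R : ℝ := (2 ^ k * (k : ℝ) ^ s) ^ (1 / (N : ℝ)) with hR
    have hR0 : 0 < R := by positivity
    have hRN : R ^ N = 2 ^ k * (k : ℝ) ^ s := by
      rw [hR, one_div]
      exact Real.rpow_inv_natCast_pow (by positivity) hNne
    have hpR : 1 ≤ p k * R := by
      rw [← one_le_pow_iff_of_nonneg (by positivity) hNne, mul_pow, hpN, hRN]
      have h1 : (k : ℝ) ^ (-s) ≤ v k := by
        have := hψk k
        exact le_add_of_nonneg_left (by positivity)
      have h2 : (k : ℝ) ^ (-s) * (k : ℝ) ^ s = 1 := by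
        rw [← Real.rpow_add hk0, neg_add_cancel, Real.rpow_zero]
      have h3 : v k / 2 ^ k * (2 ^ k * (k : ℝ) ^ s) = v k * (k : ℝ) ^ s := by field_simp
      rw [h3, ← h2]
      gcongr
    have hR2 : 2 ≤ R := by nlinarith
    set H := ⌊c / p k⌋₊ with hH
    have hcp : 1 ≤ c / p k := by rwa [le_div_iff₀ hpk, one_mul]
    have hH1 : 1 ≤ H := Nat.one_le_floor_iff _ |>.mpr hcp
    have hH1' : (1 : ℝ) ≤ H := by exact_mod_cast hH1
    have hHle : (H : ℝ) ≤ c / p k := Nat.floor_le (by positivity)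
    have hHge : c / p k ≤ 2 * H := by
      have := (Nat.lt_floor_add_one (c / p k)).le
      linarith
    have hHR : (H : ℝ) ≤ R := by
      refine hHle.trans ?_
      rw [div_le_iff₀ hpk]
      linarith
    have hHp : (m : ℝ) * H * (B * p k) ≤ 1 / 6 := by
      have h1 : (H : ℝ) * p k ≤ c := by rwa [le_div_iff₀ hpk] at hHle
      have h2 : (m : ℝ) * B * (H * p k) ≤ m * B * c := by gcongr
      have h3 : (m : ℝ) * B * c = 1 / 6 := by
        rw [hc]
        field_simp
      linarith
    refine (volume_le_of_separated L k M H B (p k) hBj hpk.le hM hH1 hHp ?_ {x | P k x}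
      fun x hx => hx.2).trans (ENNReal.ofReal_le_ofReal ?_)
    · intro q hq hqH
      refine hsep k R hk.2 hR2 hRN q hq fun j => le_trans ?_ hHR
      exact_mod_cast hqH j
    · rw [← hC, mul_assoc C]
      refine mul_le_mul_of_nonneg_left ?_ hC0
      have h1 : 1 / (H : ℝ) ≤ 2 / c * p k := by
        rw [div_le_iff₀ (by positivity)]
        rw [div_le_iff₀ hpk] at hHge
        rw [div_mul_eq_mul_div, div_mul_eq_mul_div, le_div_iff₀ hc0]
        linarith
      have h2 : v k = 2 ^ k * p k ^ N := by
        rw [hpN]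
        field_simp
      calc 2 ^ k * p k ^ d / (H : ℝ) ^ m = 2 ^ k * p k ^ d * (1 / (H : ℝ)) ^ m := by
            rw [one_div, inv_pow, div_eq_mul_inv]
        _ ≤ 2 ^ k * p k ^ d * (2 / c * p k) ^ m := by gcongr
        _ = (2 / c) ^ m * v k := by
            rw [h2, hN, pow_add, mul_pow]
            ring
  have hBC : volume {x | ∃ᶠ k in atTop, P k x} = 0 := by
    refine measure_setOfPred_frequently_eq_zero (ne_top_of_le_ne_top ?_ (ENNReal.tsum_le_tsum hvol))
    exact (hvsum.mul_left _).tsum_ofReal_ne_top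
  refine measure_mono_null ?_ hBC
  rintro x ⟨hx01, hinf⟩
  refine frequently_atTop.mpr fun K => ?_
  obtain ⟨q, ⟨hq0, hqx, hqL⟩, hqK⟩ := hinf.exists_gt (2 ^ (K + K₀ + 1))
  have hkK : K + K₀ + 1 ≤ Nat.log 2 q := Nat.le_log_of_pow_le one_lt_two hqK.le
  have hk1 : 2 ^ Nat.log 2 q ≤ q := Nat.pow_log_le_self 2 hq0.ne'
  have hψq : ψ q ≤ p (Nat.log 2 q) :=
    (hmono _ _ (hone _) (by exact_mod_cast hk1)).trans (hψp _)
  exact ⟨Nat.log 2 q, by omega, ⟨by omega, by omega⟩, hx01, q, hk1,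
    Nat.lt_pow_succ_log_self one_lt_two q, fun i => (hqx i).le.trans hψq,
    fun j => (hqL j).le.trans hψq⟩

/-- the affine parametrisation `x ↦ (x, x̃L)` -/
noncomputable def affineGraph {d N : ℕ} (L : Matrix (Fin (d + 1)) (Fin (N - d)) ℝ)
    (x : Fin d → ℝ) : EuclideanSpace ℝ (Fin N) :=
  WithLp.toLp 2 fun i => if h : (i : ℕ) < d then x ⟨i, h⟩ else
    Matrix.vecMul (Fin.cons 1 x) L ⟨i - d, by omega⟩

theorem exists_lipschitzWith_affineGraph {d N : ℕ} (L : Matrix (Fin (d + 1)) (Fin (N - d)) ℝ) :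
    ∃ K, LipschitzWith K (affineGraph L) := by
  let g : (Fin d → ℝ) →ₗ[ℝ] EuclideanSpace ℝ (Fin N) :=
    (WithLp.linearEquiv 2 ℝ (Fin N → ℝ)).symm.toLinearMap ∘ₗ LinearMap.pi fun i =>
      if h : (i : ℕ) < d then LinearMap.proj ⟨i, h⟩ else
        ∑ l : Fin d, L l.succ ⟨i - d, by omega⟩ • LinearMap.proj l
  refine ⟨‖g.toContinuousLinearMap‖₊, LipschitzWith.of_dist_le_mul fun x y => ?_⟩
  have hg : affineGraph L x - affineGraph L y = g x - g y := by
    ext i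
    by_cases h : (i : ℕ) < d
    · simp [affineGraph, g, h]
    · simp [affineGraph, g, h, Matrix.vecMul, dotProduct, Fin.sum_univ_succ, mul_comm]
  rw [dist_eq_norm, hg, ← dist_eq_norm]
  exact g.toContinuousLinearMap.lipschitz.dist_le_mul x y

open MeasureTheory in
/-- **Corollary 1.12 (i)**: if `ω_m(Ã) = N(d+1)` and `ω'_m(Ã, N(d+1)) < 1 - 2(d+1)`, then the
affine subspace `ℋ = {(x, x̃Ã) : x ∈ [0,1]^d}` is of Khintchine type for convergence. -/
theorem khintchine_type_convergence (d N : ℕ) (hd : 1 ≤ d) (hdN : d < N)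
    (A : Matrix (Fin d) (Fin (N - d)) ℝ) (α₀ : Fin (N - d) → ℝ)
    (Atil : Matrix (Fin (d + 1)) (Fin (N - d)) ℝ)
    (hAtil : Atil = Matrix.of (Fin.cons α₀ (fun i => A i)))
    (hω : multExp Atil = (((N : ℝ) * ((d : ℝ) + 1) : ℝ) : EReal))
    (hω' : multLogExp Atil ((N : ℝ) * ((d : ℝ) + 1)) <
      ((1 - 2 * ((d : ℝ) + 1) : ℝ) : EReal)) :
    ∀ ψ : ℝ → ℝ, (∀ x, 1 ≤ x → 0 < ψ x ∧ ψ x ≤ 1) →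
      (∀ x y, 1 ≤ x → x ≤ y → ψ y ≤ ψ x) →
      Summable (fun q : ℕ => ψ ((q : ℝ) + 1) ^ N) →
      μH[(d : ℝ)] (simultApprox N ψ ∩
        {z : EuclideanSpace ℝ (Fin N) | ∃ x : Fin d → ℝ,
          (∀ i, x i ∈ Set.Icc (0 : ℝ) 1) ∧
          (∀ i : Fin N, (h : (i : ℕ) < d) → z i = x ⟨i, h⟩) ∧
          (∀ j : Fin (N - d), z ⟨d + (j : ℕ), by have := j.isLt; omega⟩ =
            Matrix.vecMul (Fin.cons 1 x) Atil j)}) = 0 := by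
  intro ψ hψ hmono hsum
  obtain ⟨K, hK⟩ := exists_lipschitzWith_affineGraph (N := N) Atil
  have hnull := volume_approx_eq_zero hd (by omega : 1 ≤ N - d) (by omega) Atil hω' hψ hmono hsum
  rw [← hausdorffMeasure_pi_real, Fintype.card_fin] at hnull
  refine measure_mono_null ?_ (le_antisymm
    ((hK.hausdorffMeasure_image_le (Nat.cast_nonneg d) _).trans_eq (by rw [hnull, mul_zero]))
    zero_le)
  rintro z ⟨hz, x, hx01, hzx, hzL⟩
  refine ⟨x, ⟨hx01, hz.mono ?_⟩, ?_⟩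
  · rintro q ⟨hq0, hq⟩
    refine ⟨hq0, fun i => ?_, fun j => ?_⟩
    · have h := hq ⟨i, by omega⟩
      rwa [hzx ⟨i, by omega⟩ i.isLt] at h
    · have h := hq ⟨d + j, by omega⟩
      rwa [hzL j] at h
  · ext i
    by_cases h : (i : ℕ) < d
    · simp [affineGraph, h, hzx i h]
    · have h1 := hzL ⟨i - d, by omega⟩
      have h2 : (⟨d + (i - d), by omega⟩ : Fin N) = i := Fin.ext (by simp; omega)
      simp only [h2] at h1
      simp [affineGraph, h, h1]
end
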